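/- Suppose k = C and G is a good normal subgroup of W~ containing no reflection. For H in A(W~) let s_H be the generator of the cyclic group W~_H whose determinant is exp(2πi/|W~_H|). Then G is generated by the elements s_{H'} s_H^{-1}, where {H, H'} ranges over the pairs of hyperplanes in A'(W~) having the same image in A'bar(W~) (i.e. such that W~_H and W~_{H'} have the same image in W). -/

import Mathlib

open MvPolynomial

noncomputable section

namespace ReflQuot

variable {k : Type} [Field k]

/-- The action of an invertible matrix `g` on polynomial functions on `k^n`:
the linear form `X i` is sent to `∑ j, (g⁻¹) i j • X j`, so that
`(g • f) (v) = f (g⁻¹ ⬝ v)`. -/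
def matAct {n : ℕ} (g : Matrix.GeneralLinearGroup (Fin n) k) :
    MvPolynomial (Fin n) k →ₐ[k] MvPolynomial (Fin n) k :=
  aeval fun i => ∑ j, ((↑(g⁻¹) : Matrix (Fin n) (Fin n) k) i j) • X j

/-- The algebra endomorphism of `k[X_1,…,X_m]` sending `X i` to `∑ j, M i j • X j`. -/
def polyAct {m : ℕ} (M : Fin m → Fin m → k) :
    MvPolynomial (Fin m) k →ₐ[k] MvPolynomial (Fin m) k :=
  aeval fun i => ∑ j, M i j • X j

/-- A reflection: an automorphism of finite order whose fixed-point subspace is a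
hyperplane. -/
def IsReflection {n : ℕ} (M : Matrix (Fin n) (Fin n) k) : Prop :=
  IsOfFinOrder M ∧
    Module.finrank k (LinearMap.ker (Matrix.toLin' M - LinearMap.id)) + 1 = n

/-- A double reflection: finite order, fixed points of codimension 2. -/
def IsDoubleReflection {n : ℕ} (M : Matrix (Fin n) (Fin n) k) : Prop :=
  IsOfFinOrder M ∧
    Module.finrank k (LinearMap.ker (Matrix.toLin' M - LinearMap.id)) + 2 = n

/-- A reflection group: a group generated by its reflections. -/
def IsReflectionGroup {n : ℕ} (W : Subgroup (Matrix.GeneralLinearGroup (Fin n) k)) : Prop :=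
  Subgroup.closure {g | g ∈ W ∧ IsReflection ((g : Matrix (Fin n) (Fin n) k))} = W

/-- The algebra of `G`-invariant polynomials. -/
def invariants {n : ℕ} (G : Subgroup (Matrix.GeneralLinearGroup (Fin n) k)) :
    Subalgebra k (MvPolynomial (Fin n) k) where
  carrier := {f | ∀ g ∈ G, matAct g f = f}
  mul_mem' := fun {a b} ha hb g hg => by
    rw [map_mul, ha g hg, hb g hg]
  one_mem' := fun g _ => map_one (matAct g)
  add_mem' := fun {a b} ha hb g hg => by
    rw [map_add, ha g hg, hb g hg]
  zero_mem' := fun g _ => map_zero (matAct g)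
  algebraMap_mem' := fun r g _ => (matAct g).commutes r

/-- The linear span of products of two positive-degree invariants, i.e. `(B^G_+)^2`. -/
def sqSpan {n : ℕ} (G : Subgroup (Matrix.GeneralLinearGroup (Fin n) k)) :
    Submodule k (MvPolynomial (Fin n) k) :=
  Submodule.span k {f | ∃ u ∈ invariants G, ∃ v ∈ invariants G,
    constantCoeff u = 0 ∧ constantCoeff v = 0 ∧ f = u * v}

/-- The ideal of positive-degree elements of the polynomial ring. -/
def idealPlus (k : Type) [Field k] (m : ℕ) : Ideal (MvPolynomial (Fin m) k) :=
  Ideal.span (Set.range X)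

/-- The ideal `I` of relations between the generators `p i` of the invariant algebra:
the kernel of `k[V] = k[X_1,…,X_m] → B^G`, `X i ↦ p i`. -/
def relIdeal {n m : ℕ} (p : Fin m → MvPolynomial (Fin n) k) :
    Ideal (MvPolynomial (Fin m) k) :=
  RingHom.ker (aeval p : MvPolynomial (Fin m) k →ₐ[k] MvPolynomial (Fin n) k)

/-- The context: `Wt` is a finite reflection group on `k^n`, `G` a normal subgroup of `Wt`,
`p` a minimal system of homogeneous generators (of degrees `d`) of the invariant algebra
`B^G` whose span is `Wt`-stable (i.e. a graded `W`-equivariant section of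
`B^G_+ → B^G_+/(B^G_+)^2`), and `c w` the matrix of the action of `w` on the span of the
`p i`, giving the induced action of `W = Wt/G` on `V = k^m`. -/
structure QuotSetup {n m : ℕ} (Wt G : Subgroup (Matrix.GeneralLinearGroup (Fin n) k))
    (p : Fin m → MvPolynomial (Fin n) k) (d : Fin m → ℕ)
    (c : ↥Wt → Fin m → Fin m → k) : Prop where
  finite : (Wt : Set (Matrix.GeneralLinearGroup (Fin n) k)).Finite
  reflGroup : IsReflectionGroup Wt
  le : G ≤ Wt
  normal : ∀ w ∈ Wt, ∀ g ∈ G, w * g * w⁻¹ ∈ G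
  homog : ∀ i, (p i).IsHomogeneous (d i)
  dpos : ∀ i, 0 < d i
  gen : Algebra.adjoin k (Set.range p) = invariants G
  minimal : ∀ a : Fin m → k, (∑ i, a i • p i) ∈ sqSpan G → a = 0
  equivar : ∀ (w : ↥Wt) (i), matAct (w : Matrix.GeneralLinearGroup (Fin n) k) (p i)
      = ∑ j, c w i j • p j

/-- `W = Wt/G` acts trivially on the conormal module `I/(A_+ I)`. -/
def TrivialConormal {n m : ℕ} (Wt : Subgroup (Matrix.GeneralLinearGroup (Fin n) k))
    (p : Fin m → MvPolynomial (Fin n) k) (c : ↥Wt → Fin m → Fin m → k) : Prop :=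
  ∀ w : ↥Wt, ∀ f ∈ relIdeal p, polyAct (c w) f - f ∈ idealPlus k m * relIdeal p

/-- `G` is of complete intersection: `I` is generated by `dim V - dim Vt = m - n` elements. -/
def IsCompleteIntersection {n m : ℕ} (p : Fin m → MvPolynomial (Fin n) k) : Prop :=
  ∃ s : Finset (MvPolynomial (Fin m) k), s.card = m - n ∧ Ideal.span (s : Set _) = relIdeal p

/-- `G` is a good normal subgroup of `Wt`. -/
def IsGoodQuot {n m : ℕ} (Wt : Subgroup (Matrix.GeneralLinearGroup (Fin n) k))
    (p : Fin m → MvPolynomial (Fin n) k) (c : ↥Wt → Fin m → Fin m → k) : Prop :=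
  IsCompleteIntersection p ∧ TrivialConormal Wt p c


/-- The pointwise stabilizer of a subspace `L` in `GL_n(k)`. -/
def pointStab {n : ℕ} (L : Submodule k (Fin n → k)) :
    Subgroup (Matrix.GeneralLinearGroup (Fin n) k) where
  carrier := {g | ∀ x ∈ L, Matrix.mulVec (g : Matrix (Fin n) (Fin n) k) x = x}
  one_mem' := fun x _ => Matrix.one_mulVec x
  mul_mem' := fun {a b} ha hb x hx => by
    rw [Units.val_mul, ← Matrix.mulVec_mulVec, hb x hx, ha x hx]
  inv_mem' := fun {a} ha x hx => by
    have h1 : Matrix.mulVec (↑(a⁻¹) : Matrix (Fin n) (Fin n) k)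
        (Matrix.mulVec (↑a : Matrix (Fin n) (Fin n) k) x) = x := by
      rw [Matrix.mulVec_mulVec, ← Units.val_mul, inv_mul_cancel, Units.val_one,
        Matrix.one_mulVec]
    rw [ha x hx] at h1
    exact h1

/-- The set of reflecting hyperplanes of a subgroup `W` of `GL_n(k)`. -/
def reflHyps {n : ℕ} (W : Subgroup (Matrix.GeneralLinearGroup (Fin n) k)) :
    Set (Submodule k (Fin n → k)) :=
  {H | ∃ g ∈ W, IsReflection ((g : Matrix (Fin n) (Fin n) k)) ∧
      H = LinearMap.ker (Matrix.toLin' ((g : Matrix (Fin n) (Fin n) k)) - LinearMap.id)}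

/-- The set `A'(Wt)` of reflecting hyperplanes `H` of `Wt` such that `Wt_H ≠ G_H`. -/
def reflHyps' {n : ℕ} (Wt G : Subgroup (Matrix.GeneralLinearGroup (Fin n) k)) :
    Set (Submodule k (Fin n → k)) :=
  {H | H ∈ reflHyps Wt ∧ ¬ (Wt ⊓ pointStab H ≤ G)}

/-- `Wt_H` and `Wt_{H'}` have the same image in `W = Wt/G`. -/
def imageEq {n : ℕ} (Wt G : Subgroup (Matrix.GeneralLinearGroup (Fin n) k))
    (H H' : Submodule k (Fin n → k)) : Prop :=
  {x | ∃ g ∈ G, ∃ u ∈ Wt ⊓ pointStab H, x = g * u}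
    = {x | ∃ g ∈ G, ∃ u ∈ Wt ⊓ pointStab H', x = g * u}

/-- `e_H = |G_H|`. -/
def eH {n : ℕ} (G : Subgroup (Matrix.GeneralLinearGroup (Fin n) k))
    (H : Submodule k (Fin n → k)) : ℕ :=
  Nat.card ↥(G ⊓ pointStab H)

/-- The map `p : Vt → V`, `x ↦ (p 1 (x), …, p m (x))`. -/
def pMap {n m : ℕ} (p : Fin m → MvPolynomial (Fin n) k) (x : Fin n → k) : Fin m → k :=
  fun i => eval x (p i)

/-- The matrix of the action of (the image in `W` of) `w` on `V = k^m`. -/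
def qMat {n m : ℕ} {Wt : Subgroup (Matrix.GeneralLinearGroup (Fin n) k)}
    (c : ↥Wt → Fin m → Fin m → k) (w : ↥Wt) : Matrix (Fin m) (Fin m) k :=
  Matrix.of (c w⁻¹)

/-- The set of reflecting hyperplanes of `W = Wt/G` acting on `V = k^m`. -/
def reflHypsV {n m : ℕ} {Wt : Subgroup (Matrix.GeneralLinearGroup (Fin n) k)}
    (c : ↥Wt → Fin m → Fin m → k) : Set (Submodule k (Fin m → k)) :=
  {K | ∃ w : ↥Wt, IsReflection (qMat c w) ∧
      K = LinearMap.ker (Matrix.toLin' (qMat c w) - LinearMap.id)}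

/-- The underlying matrix of an element of a subgroup of `GL_n(k)`. -/
def matOf {n : ℕ} {Wt : Subgroup (Matrix.GeneralLinearGroup (Fin n) k)} (w : ↥Wt) :
    Matrix (Fin n) (Fin n) k :=
  ((w : Matrix.GeneralLinearGroup (Fin n) k) : Matrix (Fin n) (Fin n) k)

/-- For a reflecting hyperplane `H` of `Wt ⊆ GL_n(ℂ)`, `s` is the distinguished
generator of the (cyclic) pointwise stabilizer `Wt_H`: it generates `Wt_H` and has
determinant `exp(2πi/|Wt_H|)`. -/
def distinguishedGen {n : ℕ} (Wt : Subgroup (Matrix.GeneralLinearGroup (Fin n) ℂ))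
    (H : Submodule ℂ (Fin n → ℂ)) (s : Matrix.GeneralLinearGroup (Fin n) ℂ) : Prop :=
  s ∈ Wt ⊓ pointStab H ∧
  (∀ u ∈ Wt ⊓ pointStab H, u ∈ Subgroup.zpowers s) ∧
  Matrix.det ((s : Matrix.GeneralLinearGroup (Fin n) ℂ) : Matrix (Fin n) (Fin n) ℂ)
    = Complex.exp (2 * Real.pi * Complex.I / (Nat.card ↥(Wt ⊓ pointStab H)))

/-! ### The action of matrices on polynomials -/

/-- The linear form `∑ j, a j • X j`. -/
def linForm {n : ℕ} (a : Fin n → k) : MvPolynomial (Fin n) k := ∑ j, a j • X j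

lemma eval_linForm {n : ℕ} (a x : Fin n → k) : eval x (linForm a) = a ⬝ᵥ x := by
  simp [linForm, dotProduct, smul_eval]

lemma coeff_linForm {n : ℕ} (a : Fin n → k) (i : Fin n) :
    coeff (Finsupp.single i 1) (linForm a) = a i := by
  classical
  simp [linForm, coeff_sum, coeff_X, Finsupp.single_left_inj]

lemma linForm_ne_zero {n : ℕ} {a : Fin n → k} (ha : a ≠ 0) : linForm a ≠ 0 := by
  intro h
  apply ha
  funext i
  simp [← coeff_linForm a i, h]

lemma totalDegree_linForm_le {n : ℕ} (a : Fin n → k) : (linForm a).totalDegree ≤ 1 := by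
  refine totalDegree_finsetSum_le fun i _ => (totalDegree_smul_le _ _).trans ?_
  simp

lemma irreducible_linForm {n : ℕ} {a : Fin n → k} (ha : a ≠ 0) : Irreducible (linForm a) := by
  obtain ⟨i, hi⟩ := Function.ne_iff.mp ha
  apply irreducible_of_totalDegree_eq_one
  · refine le_antisymm (totalDegree_linForm_le a) (Nat.one_le_iff_ne_zero.mpr fun h => ?_)
    rw [totalDegree_eq_zero_iff_eq_C] at h
    apply hi
    rw [← coeff_linForm a i, h, coeff_C, if_neg]
    · rfl
    · intro h
      simpa using DFunLike.congr_fun h i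
  · intro x hx
    refine (isUnit_iff_ne_zero).mpr fun h0 => hi ?_
    simpa [h0, coeff_linForm] using hx (Finsupp.single i 1)

lemma totalDegree_aeval_le {σ τ : Type*} (f : σ → MvPolynomial τ k)
    (hf : ∀ i, (f i).totalDegree ≤ 1) (q : MvPolynomial σ k) :
    (aeval f q).totalDegree ≤ q.totalDegree := by
  rw [aeval_def, eval₂_eq]
  refine totalDegree_finsetSum_le fun e he => (totalDegree_mul _ _).trans ?_
  rw [algebraMap_eq, totalDegree_C, zero_add]
  refine ((totalDegree_finsetProd _ _).trans
    (Finset.sum_le_sum fun _ _ => (totalDegree_pow _ _).trans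
      (Nat.mul_le_mul_left _ (hf _)))).trans ?_
  simpa [Finsupp.sum] using le_totalDegree he

section Action

variable {n : ℕ}

lemma matAct_X (g : Matrix.GeneralLinearGroup (Fin n) k) (i : Fin n) :
    matAct g (X i) = linForm ((↑(g⁻¹) : Matrix (Fin n) (Fin n) k) i) := by
  simp [matAct, linForm]

lemma totalDegree_matAct_le (g : Matrix.GeneralLinearGroup (Fin n) k)
    (q : MvPolynomial (Fin n) k) : (matAct g q).totalDegree ≤ q.totalDegree :=
  totalDegree_aeval_le _ (fun _ => totalDegree_linForm_le _) q

lemma eval_matAct (g : Matrix.GeneralLinearGroup (Fin n) k) (x : Fin n → k)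
    (f : MvPolynomial (Fin n) k) :
    eval x (matAct g f) = eval ((↑(g⁻¹) : Matrix (Fin n) (Fin n) k).mulVec x) f := by
  induction f using MvPolynomial.induction_on with
  | C a => simp [matAct]
  | add p q hp hq => rw [map_add, map_add, map_add, hp, hq]
  | mul_X p _ hp => rw [map_mul, map_mul, map_mul, hp, matAct_X, eval_linForm, eval_X]; rfl

variable [Infinite k]

lemma matAct_mul (g h : Matrix.GeneralLinearGroup (Fin n) k) (f : MvPolynomial (Fin n) k) :
    matAct (g * h) f = matAct g (matAct h f) := by
  refine MvPolynomial.funext fun x => ?_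
  simp only [eval_matAct, mul_inv_rev, Units.val_mul, Matrix.mulVec_mulVec]

lemma matAct_one (f : MvPolynomial (Fin n) k) :
    matAct (1 : Matrix.GeneralLinearGroup (Fin n) k) f = f := by
  refine MvPolynomial.funext fun x => ?_
  simp [eval_matAct]

lemma matAct_inv_matAct (g : Matrix.GeneralLinearGroup (Fin n) k) (f : MvPolynomial (Fin n) k) :
    matAct g⁻¹ (matAct g f) = f := by
  rw [← matAct_mul, inv_mul_cancel, matAct_one]

lemma matAct_pow_sub (g : Matrix.GeneralLinearGroup (Fin n) k) {f b : MvPolynomial (Fin n) k}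
    (hf : matAct g f = f + b) (hb : matAct g b = b) (j : ℕ) :
    matAct (g ^ j) f = f + j • b := by
  induction j with
  | zero => simp [matAct_one]
  | succ j ih => rw [pow_succ', matAct_mul, ih, map_add, map_nsmul, hf, hb, succ_nsmul]; ring

/-- If `g` has finite order and `g • f - f` is fixed by `g`, then `f` is fixed by `g`. -/
lemma matAct_eq_self_of_sub_fixed [CharZero k] {g : Matrix.GeneralLinearGroup (Fin n) k}
    (hg : IsOfFinOrder g) {f b : MvPolynomial (Fin n) k}
    (hf : matAct g f = f + b) (hb : matAct g b = b) : b = 0 := by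
  have h := matAct_pow_sub g hf hb (orderOf g)
  rw [pow_orderOf_eq_one, matAct_one, left_eq_add, nsmul_eq_mul] at h
  rcases mul_eq_zero.mp h with h | h
  · exact absurd (Nat.cast_eq_zero.mp h) hg.orderOf_pos.ne'
  · exact h

end Action

/-! ### Interpolation on finite sets of points -/

lemma exists_eval_one_vanishing {n : ℕ} (S : Finset (Fin n → k)) (v : Fin n → k) (hv : v ∉ S) :
    ∃ e : MvPolynomial (Fin n) k, eval v e = 1 ∧ ∀ x ∈ S, eval x e = 0 := by
  classical
  have h : ∀ x : Fin n → k, ∃ e : MvPolynomial (Fin n) k, eval v e = 1 ∧ (x ≠ v → eval x e = 0) := by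
    intro x
    by_cases hx : x = v
    · exact ⟨1, by simp, fun h => absurd hx h⟩
    · obtain ⟨i, hi⟩ := Function.ne_iff.mp hx
      refine ⟨C ((v i - x i)⁻¹) * (X i - C (x i)), ?_, fun _ => by simp⟩
      simp [inv_mul_cancel₀ (sub_ne_zero.mpr (Ne.symm hi))]
  choose e he using h
  refine ⟨∏ x ∈ S, e x, ?_, fun x hx => ?_⟩
  · rw [map_prod]
    exact Finset.prod_eq_one fun x _ => (he x).1
  · rw [map_prod]
    exact Finset.prod_eq_zero hx ((he x).2 fun h => hv (h ▸ hx))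

lemma exists_eval_one_on_vanishing {n : ℕ} (S T : Finset (Fin n → k)) (hST : Disjoint S T) :
    ∃ e : MvPolynomial (Fin n) k, (∀ x ∈ T, eval x e = 1) ∧ ∀ x ∈ S, eval x e = 0 := by
  classical
  have h : ∀ t : Fin n → k, ∃ e : MvPolynomial (Fin n) k,
      t ∈ T → (eval t e = 1 ∧ ∀ x ∈ S, eval x e = 0) := by
    intro t
    by_cases ht : t ∈ T
    · obtain ⟨e, he⟩ := exists_eval_one_vanishing S t (Finset.disjoint_right.mp hST ht)
      exact ⟨e, fun _ => he⟩
    · exact ⟨0, fun h => absurd h ht⟩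
  choose e he using h
  refine ⟨1 - ∏ t ∈ T, (1 - e t), fun x hx => ?_, fun x hx => ?_⟩
  · rw [map_sub, map_prod, Finset.prod_eq_zero hx (by simp [(he x hx).1])]
    simp
  · rw [map_sub, map_prod, Finset.prod_eq_one fun t ht => by simp [(he t ht).2 x hx]]
    simp

/-! ### Invariants of finite groups -/

section Invariants

variable {n : ℕ}

lemma mulVec_inv_mulVec (g : Matrix.GeneralLinearGroup (Fin n) k) (x : Fin n → k) :
    (↑(g⁻¹) : Matrix (Fin n) (Fin n) k).mulVec ((g : Matrix (Fin n) (Fin n) k).mulVec x) = x := by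
  rw [Matrix.mulVec_mulVec, ← Units.val_mul, inv_mul_cancel, Units.val_one, Matrix.one_mulVec]

lemma mulVec_mulVec_inv (g : Matrix.GeneralLinearGroup (Fin n) k) (x : Fin n → k) :
    (g : Matrix (Fin n) (Fin n) k).mulVec ((↑(g⁻¹) : Matrix (Fin n) (Fin n) k).mulVec x) = x := by
  rw [Matrix.mulVec_mulVec, ← Units.val_mul, mul_inv_cancel, Units.val_one, Matrix.one_mulVec]

/-- The fixed space of a matrix. -/
def fixedSpace (g : Matrix (Fin n) (Fin n) k) : Submodule k (Fin n → k) :=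
  LinearMap.ker (Matrix.toLin' g - LinearMap.id)

lemma mem_fixedSpace {g : Matrix (Fin n) (Fin n) k} {x : Fin n → k} :
    x ∈ fixedSpace g ↔ g.mulVec x = x := by
  simp [fixedSpace, sub_eq_zero]

lemma eq_one_of_fixedSpace_eq_top {g : Matrix.GeneralLinearGroup (Fin n) k}
    (h : fixedSpace (g : Matrix (Fin n) (Fin n) k) = ⊤) : g = 1 := by
  apply Units.ext
  apply Matrix.toLin'.injective
  ext1 x
  have hx : ∀ x, (g : Matrix (Fin n) (Fin n) k).mulVec x = x := fun x =>
    mem_fixedSpace.mp (h ▸ Submodule.mem_top)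
  ext
  simp [hx]

/-- The sum of the translates of a polynomial under a finite group. -/
def trace (G : Subgroup (Matrix.GeneralLinearGroup (Fin n) k)) [Fintype G]
    (f : MvPolynomial (Fin n) k) : MvPolynomial (Fin n) k :=
  ∑ g : G, matAct (g : Matrix.GeneralLinearGroup (Fin n) k) f

lemma trace_mul_of_mem (G : Subgroup (Matrix.GeneralLinearGroup (Fin n) k)) [Fintype G]
    (f : MvPolynomial (Fin n) k) {u : MvPolynomial (Fin n) k} (hu : u ∈ invariants G) :
    trace G (f * u) = trace G f * u := by
  rw [trace, trace, Finset.sum_mul]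
  refine Finset.sum_congr rfl fun g _ => ?_
  rw [map_mul, hu g g.2]

lemma trace_add (G : Subgroup (Matrix.GeneralLinearGroup (Fin n) k)) [Fintype G]
    (f h : MvPolynomial (Fin n) k) : trace G (f + h) = trace G f + trace G h := by
  simp [trace, Finset.sum_add_distrib]

variable [Infinite k]

lemma trace_mem (G : Subgroup (Matrix.GeneralLinearGroup (Fin n) k)) [Fintype G]
    (f : MvPolynomial (Fin n) k) : trace G f ∈ invariants G := by
  intro g hg
  rw [trace, map_sum]
  simp_rw [← matAct_mul]
  exact Fintype.sum_equiv (Equiv.mulLeft (⟨g, hg⟩ : G)) _ _ fun _ => rfl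

/-- Invariants of a finite group separate its orbits. -/
lemma exists_mulVec_eq_of_eval_invariants_eq (G : Subgroup (Matrix.GeneralLinearGroup (Fin n) k))
    [Finite G] {x y : Fin n → k} (h : ∀ b ∈ invariants G, eval x b = eval y b) :
    ∃ g ∈ G, y = (g : Matrix (Fin n) (Fin n) k).mulVec x := by
  classical
  have := Fintype.ofFinite G
  by_contra! hne
  let orb : (Fin n → k) → Finset (Fin n → k) := fun z => Finset.univ.image fun g : G =>
    ((↑((g : Matrix.GeneralLinearGroup (Fin n) k)⁻¹)) : Matrix (Fin n) (Fin n) k).mulVec z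
  have hdisj : Disjoint (orb x) (orb y) := by
    rw [Finset.disjoint_left]
    intro z hzx hzy
    simp only [orb, Finset.mem_image, Finset.mem_univ, true_and] at hzx hzy
    obtain ⟨g, rfl⟩ := hzx
    obtain ⟨g', hg'⟩ := hzy
    refine hne (g' * g⁻¹) (G.mul_mem g'.2 (G.inv_mem g.2)) ?_
    rw [Units.val_mul, ← Matrix.mulVec_mulVec, Subgroup.coe_inv, ← hg', mulVec_mulVec_inv]
  obtain ⟨e, he1, he0⟩ := exists_eval_one_on_vanishing _ _ hdisj
  let b := ∏ g : G, matAct (g : Matrix.GeneralLinearGroup (Fin n) k) e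
  have hb : b ∈ invariants G := by
    intro g hg
    simp only [b, map_prod]
    simp_rw [← matAct_mul]
    exact Fintype.prod_equiv (Equiv.mulLeft (⟨g, hg⟩ : G)) _ _ fun _ => rfl
  have hbx : eval x b = 0 := by
    simp only [b, map_prod, eval_matAct]
    exact Finset.prod_eq_zero (Finset.mem_univ 1)
      (he0 _ (Finset.mem_image_of_mem _ (Finset.mem_univ _)))
  have hby : eval y b = 1 := by
    simp only [b, map_prod, eval_matAct]
    exact Finset.prod_eq_one fun g _ => he1 _ (Finset.mem_image_of_mem _ (Finset.mem_univ _))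
  simpa [hbx, hby] using h b hb

/-- If finitely many subspaces cover a subspace `L`, one of them contains it. -/
lemma exists_le_of_forall_mem {ι E : Type*} [Finite ι] [AddCommGroup E] [Module k E]
    (L : Submodule k E) (F : ι → Submodule k E)
    (h : ∀ x ∈ L, ∃ i, x ∈ F i) : ∃ i, L ≤ F i := by
  obtain ⟨i, hi⟩ := Subspace.exists_eq_top_of_iUnion_eq_univ
    (p := fun i => (F i).comap L.subtype) (by
      ext x
      simpa using h x x.2)
  exact ⟨i, fun x hx => by simpa using (hi ▸ Submodule.mem_top : (⟨x, hx⟩ : L) ∈ (F i).comap L.subtype)⟩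

/-- The Galois correspondence for finite linear groups: an element fixing all invariants of `N`
belongs to `N`. -/
lemma mem_of_fixes_invariants {W N : Subgroup (Matrix.GeneralLinearGroup (Fin n) k)}
    [Finite W] (hN : N ≤ W) {w : Matrix.GeneralLinearGroup (Fin n) k} (hw : w ∈ W)
    (h : ∀ b ∈ invariants N, matAct w b = b) : w ∈ N := by
  have : Finite N := Finite.of_injective _ (Subgroup.inclusion_injective hN)
  obtain ⟨x, hx⟩ : ∃ x : Fin n → k, ∀ g ∈ W, (g : Matrix (Fin n) (Fin n) k).mulVec x = x → g = 1 := by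
    by_contra! hcov
    obtain ⟨⟨g, hg⟩, hle⟩ := exists_le_of_forall_mem (⊤ : Submodule k (Fin n → k))
      (fun g : {g : W // (g : Matrix.GeneralLinearGroup (Fin n) k) ≠ 1} =>
        fixedSpace ((g : Matrix.GeneralLinearGroup (Fin n) k) : Matrix (Fin n) (Fin n) k))
      (fun x _ => by
        obtain ⟨g, hg, hgx, hg1⟩ := hcov x
        exact ⟨⟨⟨g, hg⟩, hg1⟩, mem_fixedSpace.mpr hgx⟩)
    exact hg (eq_one_of_fixedSpace_eq_top (top_le_iff.mp hle))
  obtain ⟨g, hg, hgx⟩ := exists_mulVec_eq_of_eval_invariants_eq N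
    (x := x) (y := (↑(w⁻¹) : Matrix (Fin n) (Fin n) k).mulVec x)
    (fun b hb => by rw [← eval_matAct, h b hb])
  have h1 : w * g = 1 := hx _ (W.mul_mem hw (hN hg)) (by
    rw [Units.val_mul, ← Matrix.mulVec_mulVec, ← hgx, mulVec_mulVec_inv])
  rw [eq_inv_of_mul_eq_one_left h1]
  exact N.inv_mem hg

end Invariants

/-! ### Points with trivial stabilizer -/

section Etale

variable {n : ℕ}

lemma mem_span_X_sub_C (v : Fin n → k) {b : MvPolynomial (Fin n) k} (hb : eval v b = 0) :
    b ∈ Ideal.span (Set.range fun i => X i - C (v i)) := by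
  have h : ∀ b : MvPolynomial (Fin n) k,
      b - C (eval v b) ∈ Ideal.span (Set.range fun i => X i - C (v i)) := by
    intro b
    induction b using MvPolynomial.induction_on with
    | C a => simp
    | add p q hp hq =>
      rw [map_add, map_add, add_sub_add_comm]
      exact Ideal.add_mem _ hp hq
    | mul_X p i hp =>
      have : p * X i - C (eval v (p * X i))
          = X i * (p - C (eval v p)) + C (eval v p) * (X i - C (v i)) := by
        simp only [map_mul, eval_X]
        ring
      rw [this]
      exact Ideal.add_mem _ (Ideal.mul_mem_left _ _ hp)
        (Ideal.mul_mem_left _ _ (Ideal.subset_span ⟨i, rfl⟩))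
  simpa [hb] using h b

lemma exists_eval_translates (G : Subgroup (Matrix.GeneralLinearGroup (Fin n) k)) [Finite G]
    {v : Fin n → k}
    (hv : ∀ g ∈ G, (g : Matrix (Fin n) (Fin n) k).mulVec v = v → g = 1) :
    ∃ e : MvPolynomial (Fin n) k, eval v e = 1 ∧ ∀ g ∈ G, g ≠ 1 → eval v (matAct g e) = 0 := by
  classical
  have := Fintype.ofFinite G
  obtain ⟨e, he1, he0⟩ := exists_eval_one_vanishing
    ((Finset.univ.filter fun g : G => g ≠ 1).image fun g : G =>
      ((↑((g : Matrix.GeneralLinearGroup (Fin n) k)⁻¹)) : Matrix (Fin n) (Fin n) k).mulVec v) v (by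
      simp only [Finset.mem_image, Finset.mem_filter, Finset.mem_univ, true_and, not_exists, not_and]
      intro g hg hgv
      exact hg (inv_eq_one.mp (Subtype.ext (hv _ (G.inv_mem g.2) hgv))))
  refine ⟨e, he1, fun g hg hg1 => ?_⟩
  rw [eval_matAct]
  refine he0 _ (Finset.mem_image_of_mem (a := (⟨g, hg⟩ : G)) _ ?_)
  exact Finset.mem_filter.mpr ⟨Finset.mem_univ _, fun h => hg1 (congrArg Subtype.val h)⟩

lemma eval_trace_mul (G : Subgroup (Matrix.GeneralLinearGroup (Fin n) k)) [Fintype G] [Infinite k]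
    {v : Fin n → k} {e : MvPolynomial (Fin n) k}
    (he : ∀ g ∈ G, g ≠ 1 → eval v (matAct g e) = 0) (b : MvPolynomial (Fin n) k) :
    eval v (trace G (e * b)) = eval v e * eval v b := by
  classical
  rw [trace, map_sum, Finset.sum_eq_single 1]
  · simp [matAct_one]
  · intro g _ hg
    rw [map_mul, map_mul, he g g.2 (fun h => hg (Subtype.ext h)), zero_mul]
  · simp

variable [Infinite k]

/-- At a point with trivial stabilizer, the invariants vanishing at the point locally generate
its maximal ideal. -/
lemma exists_mul_mem_span_invariants (G : Subgroup (Matrix.GeneralLinearGroup (Fin n) k))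
    [Finite G] {v : Fin n → k}
    (hv : ∀ g ∈ G, (g : Matrix (Fin n) (Fin n) k).mulVec v = v → g = 1) :
    ∃ r : MvPolynomial (Fin n) k, eval v r = 1 ∧ ∀ b, eval v b = 0 →
      r * b ∈ Ideal.span {u | u ∈ invariants G ∧ eval v u = 0} := by
  classical
  have := Fintype.ofFinite G
  obtain ⟨e, he1, he0⟩ := exists_eval_translates G hv
  set m : Ideal (MvPolynomial (Fin n) k) := RingHom.ker (eval v) with hm
  set J : Ideal (MvPolynomial (Fin n) k) := Ideal.span {u | u ∈ invariants G ∧ eval v u = 0}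
  have hle : m ≤ J ⊔ m • m := by
    intro b hb
    refine (Ideal.span_le.mpr ?_ : Ideal.span (Set.range fun i => X i - C (v i)) ≤ _)
      (mem_span_X_sub_C v hb)
    rintro _ ⟨i, rfl⟩
    set z : MvPolynomial (Fin n) k := X i - C (v i)
    have hz : z ∈ m := by simp [m, z, RingHom.mem_ker]
    have hu : trace G (e * (e * z)) ∈ J := by
      refine Ideal.subset_span ⟨trace_mem _ _, ?_⟩
      rw [eval_trace_mul G he0]
      simp [z]
    have hd : trace G (e * (e * z)) - z ∈ m • m := by
      rw [trace, ← Finset.add_sum_erase _ _ (Finset.mem_univ (1 : G)), OneMemClass.coe_one,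
        matAct_one, add_sub_right_comm]
      refine Ideal.add_mem _ ?_ (Ideal.sum_mem _ fun g hg => ?_)
      · have : e * (e * z) - z = (e * e - 1) * z := by ring
        rw [this]
        exact Ideal.mul_mem_mul (by simp [m, RingHom.mem_ker, he1]) hz
      · have hg0 := he0 g g.2 (fun h => (Finset.ne_of_mem_erase hg) (Subtype.ext h))
        rw [map_mul, map_mul]
        exact Ideal.mul_mem_mul hg0 (Ideal.mul_mem_right _ _ hg0)
    have hmem := Ideal.sub_mem (J ⊔ m • m) (Ideal.mem_sup_left hu) (Ideal.mem_sup_right hd)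
    rwa [sub_sub_cancel] at hmem
  obtain ⟨r, hr, hrm⟩ := Submodule.exists_sub_one_mem_and_smul_le_of_fg_of_le_sup
    (IsNoetherian.noetherian m) le_rfl hle
  refine ⟨r, by simpa [m, RingHom.mem_ker, sub_eq_zero] using hr, fun b hb => ?_⟩
  exact hrm (Submodule.smul_mem_pointwise_smul b r m hb)

/-- A tangent vector of the quotient at the image of a point `v` with trivial stabilizer kills the
invariants that vanish to second order at `v`. -/
lemma tangent_eq_zero_of_eq_mul (G : Subgroup (Matrix.GeneralLinearGroup (Fin n) k))
    [Finite G] {v : Fin n → k}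
    (hv : ∀ g ∈ G, (g : Matrix (Fin n) (Fin n) k).mulVec v = v → g = 1)
    (ψ : invariants G →ₐ[k] DualNumber k) (hψ : ∀ u, (ψ u).fst = eval v (u : MvPolynomial (Fin n) k))
    {q : invariants G} {a b : MvPolynomial (Fin n) k} (ha : eval v a = 0) (hb : eval v b = 0)
    (hq : (q : MvPolynomial (Fin n) k) = a * b) : ψ q = 0 := by
  classical
  have := Fintype.ofFinite G
  obtain ⟨e, he1, he0⟩ := exists_eval_translates G hv
  obtain ⟨r, hr1, hr⟩ := exists_mul_mem_span_invariants G hv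
  let T : MvPolynomial (Fin n) k → DualNumber k := fun f => ψ ⟨trace G (e * f), trace_mem _ _⟩
  have hTadd : ∀ f h, T (f + h) = T f + T h := by
    intro f h
    rw [← map_add]
    exact congrArg ψ (Subtype.ext (by simp [mul_add, trace_add]))
  have hTmul : ∀ f (u : invariants G), T (f * u) = T f * ψ u := by
    intro f u
    rw [← map_mul]
    exact congrArg ψ (Subtype.ext (by simp [← mul_assoc, trace_mul_of_mem G _ u.2]))
  have hT0 : T 0 = 0 := by simpa using hTadd 0 0
  have hzero : ∀ x ∈ Ideal.span {u | u ∈ invariants G ∧ eval v u = 0}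
      * Ideal.span {u | u ∈ invariants G ∧ eval v u = 0}, ∀ f, T (f * x) = 0 := by
    intro x hx
    rw [Ideal.span_mul_span'] at hx
    induction hx using Submodule.span_induction with
    | zero => exact fun f => by rw [mul_zero, hT0]
    | add x y _ _ hx hy => exact fun f => by rw [mul_add, hTadd, hx, hy, add_zero]
    | smul a x _ hx => exact fun f => by rw [smul_eq_mul, ← mul_assoc, hx]
    | mem x hx =>
      obtain ⟨u, ⟨hu, hu0⟩, u', ⟨hu', hu0'⟩, rfl⟩ := Set.mem_mul.mp hx
      intro f
      have hψ0 : ψ ⟨u, hu⟩ * ψ ⟨u', hu'⟩ = 0 := by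
        ext <;> simp [hψ, hu0, hu0']
      rw [← mul_assoc, hTmul (f * u) ⟨u', hu'⟩, hTmul f ⟨u, hu⟩, mul_assoc, hψ0, mul_zero]
  have h1 : T (r * r * q) = 0 := by
    rw [← one_mul (r * r * (q : MvPolynomial (Fin n) k))]
    refine hzero _ ?_ 1
    have : r * r * (q : MvPolynomial (Fin n) k) = (r * a) * (r * b) := by rw [hq]; ring
    rw [this]
    exact Ideal.mul_mem_mul (hr a ha) (hr b hb)
  rw [hTmul] at h1
  have hunit : IsUnit (T (r * r)) := by
    rw [TrivSqZeroExt.isUnit_iff_isUnit_fst, hψ, eval_trace_mul G he0]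
    simp [he1, hr1]
  exact (hunit.mul_right_eq_zero).mp h1

end Etale

/-! ### The action on the space of generators and the conormal module -/

section Conormal

variable {n m : ℕ}

lemma polyAct_linForm (M : Fin m → Fin m → k) (a : Fin m → k) :
    polyAct M (linForm a) = linForm (fun j => ∑ i, a i * M i j) := by
  simp only [polyAct, linForm, map_sum, map_smul, aeval_X, Finset.smul_sum, Finset.sum_smul,
    mul_smul]
  exact Finset.sum_comm

lemma aeval_linForm {R : Type*} [CommRing R] [Algebra k R] (p : Fin m → R) (a : Fin m → k) :
    aeval p (linForm a) = ∑ i, a i • p i := by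
  simp [linForm]

lemma X_eq_linForm (i : Fin m) : (X i : MvPolynomial (Fin m) k) = linForm (Pi.single i 1) := by
  classical
  simp [linForm, Pi.single_apply, ite_smul]

/-- The evaluation of polynomials at the tangent vector `ζ` at the point `y`. -/
def tangentEval (y ζ : Fin m → k) : MvPolynomial (Fin m) k →ₐ[k] DualNumber k :=
  aeval fun i => (TrivSqZeroExt.inl (y i) + TrivSqZeroExt.inr (ζ i) : DualNumber k)

lemma fst_tangentEval (y ζ : Fin m → k) (F : MvPolynomial (Fin m) k) :
    (tangentEval y ζ F).fst = eval y F := by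
  induction F using MvPolynomial.induction_on with
  | C a => simp [tangentEval, TrivSqZeroExt.algebraMap_eq_inl]
  | add p q hp hq => rw [map_add, map_add, TrivSqZeroExt.fst_add, hp, hq]
  | mul_X p i hp => rw [map_mul, map_mul, TrivSqZeroExt.fst_mul, hp]; simp [tangentEval]

lemma snd_tangentEval_sub (y ζ ζ' : Fin m → k) (F : MvPolynomial (Fin m) k) :
    (tangentEval y (ζ - ζ') F).snd = (tangentEval y ζ F).snd - (tangentEval y ζ' F).snd := by
  induction F using MvPolynomial.induction_on with
  | C a => simp [tangentEval, TrivSqZeroExt.algebraMap_eq_inl]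
  | add p q hp hq => simp only [map_add, TrivSqZeroExt.snd_add, hp, hq]; ring
  | mul_X p i hp =>
    simp only [map_mul, TrivSqZeroExt.snd_mul, hp, fst_tangentEval]
    simp [tangentEval]
    ring

lemma tangentEval_linForm (y ζ a : Fin m → k) : (tangentEval y ζ (linForm a)).snd = a ⬝ᵥ ζ := by
  rw [tangentEval, aeval_linForm, TrivSqZeroExt.snd_sum]
  simp [dotProduct]

lemma tangentEval_polyAct (M : Fin m → Fin m → k) (y ζ : Fin m → k) (F : MvPolynomial (Fin m) k) :
    tangentEval y ζ (polyAct M F)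
      = tangentEval ((Matrix.of M).mulVec y) ((Matrix.of M).mulVec ζ) F := by
  rw [← AlgHom.comp_apply]
  congr 1
  refine algHom_ext fun i => ?_
  ext
  · rw [AlgHom.comp_apply, X_eq_linForm, polyAct_linForm, fst_tangentEval, fst_tangentEval,
      eval_linForm, eval_linForm]
    simp [dotProduct, Matrix.mulVec, Pi.single_apply]
  · rw [AlgHom.comp_apply, X_eq_linForm, polyAct_linForm, tangentEval_linForm, tangentEval_linForm]
    simp [dotProduct, Matrix.mulVec, Pi.single_apply]

variable {Wt G : Subgroup (Matrix.GeneralLinearGroup (Fin n) k)}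
  {p : Fin m → MvPolynomial (Fin n) k} {d : Fin m → ℕ} {c : ↥Wt → Fin m → Fin m → k}

lemma QuotSetup.eq_zero_of_sum_eq_zero (h : QuotSetup Wt G p d c) {a : Fin m → k}
    (ha : ∑ i, a i • p i = 0) : a = 0 :=
  h.minimal a (ha ▸ Submodule.zero_mem _)

lemma QuotSetup.aeval_polyAct (h : QuotSetup Wt G p d c) (w : Wt) (F : MvPolynomial (Fin m) k) :
    aeval p (polyAct (c w) F) = matAct (w : Matrix.GeneralLinearGroup (Fin n) k) (aeval p F) := by
  rw [← AlgHom.comp_apply, ← AlgHom.comp_apply]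
  congr 1
  refine algHom_ext fun i => ?_
  simp [polyAct, h.equivar]

lemma QuotSetup.polyAct_mem_relIdeal (h : QuotSetup Wt G p d c) (w : Wt)
    {F : MvPolynomial (Fin m) k} (hF : F ∈ relIdeal p) : polyAct (c w) F ∈ relIdeal p := by
  have hF' : aeval p F = 0 := hF
  change aeval p (polyAct (c w) F) = 0
  rw [h.aeval_polyAct, hF', map_zero]

lemma QuotSetup.finite_coe (h : QuotSetup Wt G p d c) : Finite Wt := h.finite

lemma QuotSetup.finite_normal (h : QuotSetup Wt G p d c) : Finite G :=
  h.finite.subset h.le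

/-- The ideal generated by the invariant relations. -/
def invRelIdeal (p : Fin m → MvPolynomial (Fin n) k) (c : ↥Wt → Fin m → Fin m → k) :
    Ideal (MvPolynomial (Fin m) k) :=
  Ideal.span {F | F ∈ relIdeal p ∧ ∀ w, polyAct (c w) F = F}

lemma QuotSetup.aeval_mem_invariants (h : QuotSetup Wt G p d c) (F : MvPolynomial (Fin m) k) :
    aeval p F ∈ invariants G := by
  rw [← h.gen, Algebra.adjoin_range_eq_range_aeval]
  exact ⟨F, rfl⟩

lemma QuotSetup.exists_aeval_eq (h : QuotSetup Wt G p d c) {b : MvPolynomial (Fin n) k}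
    (hb : b ∈ invariants G) : ∃ F : MvPolynomial (Fin m) k, aeval p F = b := by
  rwa [← h.gen, Algebra.adjoin_range_eq_range_aeval] at hb

section

variable [Infinite k]

lemma QuotSetup.polyAct_mul (h : QuotSetup Wt G p d c) (s w : Wt) (F : MvPolynomial (Fin m) k) :
    polyAct (c s) (polyAct (c w) F) = polyAct (c (s * w)) F := by
  rw [← AlgHom.comp_apply]
  congr 1
  refine algHom_ext fun i => ?_
  rw [AlgHom.comp_apply]
  have h1 : aeval p (polyAct (c s) (polyAct (c w) (X i))) = aeval p (polyAct (c (s * w)) (X i)) := by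
    simp only [h.aeval_polyAct, Subgroup.coe_mul, matAct_mul]
  rw [X_eq_linForm, polyAct_linForm, polyAct_linForm, polyAct_linForm] at h1 ⊢
  rw [aeval_linForm, aeval_linForm, ← sub_eq_zero, ← Finset.sum_sub_distrib] at h1
  simp_rw [← sub_smul] at h1
  exact congrArg linForm (sub_eq_zero.mp (h.eq_zero_of_sum_eq_zero h1))

end

/-- If `W` acts trivially on the conormal module, then the ideal of relations is generated, near
the origin, by invariant relations. -/
lemma QuotSetup.exists_mul_mem_invRelIdeal [CharZero k] (h : QuotSetup Wt G p d c)
    (htriv : TrivialConormal Wt p c) :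
    ∃ r : MvPolynomial (Fin m) k, eval 0 r = 1 ∧ ∀ F ∈ relIdeal p, r * F ∈ invRelIdeal p c := by
  have := h.finite_coe
  have := Fintype.ofFinite Wt
  have hle : relIdeal p ≤ invRelIdeal p c ⊔ idealPlus k m • relIdeal p := by
    intro F hF
    set N : k := (Fintype.card Wt : k)
    have hN : N ≠ 0 := Nat.cast_ne_zero.mpr Fintype.card_ne_zero
    have h1 : ∑ w, polyAct (c w) F ∈ invRelIdeal p c := by
      refine Ideal.subset_span ⟨Ideal.sum_mem _ fun w _ => h.polyAct_mem_relIdeal w hF, fun s => ?_⟩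
      rw [map_sum]
      simp_rw [h.polyAct_mul]
      exact Fintype.sum_equiv (Equiv.mulLeft s) _ _ fun _ => rfl
    have h2 : ∑ w, (polyAct (c w) F - F) ∈ idealPlus k m • relIdeal p :=
      Ideal.sum_mem _ fun w _ => htriv w F hF
    have h3 := Ideal.mul_mem_left _ (C N⁻¹)
      (Ideal.sub_mem (invRelIdeal p c ⊔ idealPlus k m • relIdeal p)
        (Ideal.mem_sup_left h1) (Ideal.mem_sup_right h2))
    rwa [Finset.sum_sub_distrib, sub_sub_cancel, Finset.sum_const, Finset.card_univ,
      nsmul_eq_mul, ← mul_assoc, ← map_natCast (C : k →+* MvPolynomial (Fin m) k), ← map_mul,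
      inv_mul_cancel₀ hN, map_one, one_mul] at h3
  obtain ⟨r, hr, hrI⟩ := Submodule.exists_sub_one_mem_and_smul_le_of_fg_of_le_sup
    (IsNoetherian.noetherian (relIdeal p)) le_rfl hle
  refine ⟨r, ?_, fun F hF => hrI (Submodule.smul_mem_pointwise_smul F r _ hF)⟩
  have hker : idealPlus k m ≤ RingHom.ker (eval (0 : Fin m → k)) := by
    refine Ideal.span_le.mpr ?_
    rintro _ ⟨i, rfl⟩
    simp [RingHom.mem_ker]
  have := hker hr
  rwa [RingHom.mem_ker, map_sub, map_one, sub_eq_zero] at this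

/-- An element of `V^*` vanishing to second order at a suitable fixed point of `s` is fixed
by `s`. -/
lemma QuotSetup.matAct_eq_self_of_eq_mul [Infinite k] (h : QuotSetup Wt G p d c)
    {r : MvPolynomial (Fin m) k} (hr : ∀ F ∈ relIdeal p, r * F ∈ invRelIdeal p c)
    {v : Fin n → k} (hv : ∀ g ∈ G, (g : Matrix (Fin n) (Fin n) k).mulVec v = v → g = 1)
    (hrv : eval (pMap p v) r ≠ 0) {s : Matrix.GeneralLinearGroup (Fin n) k} (hs : s ∈ Wt)
    (hsv : (s : Matrix (Fin n) (Fin n) k).mulVec v = v) {q a b : MvPolynomial (Fin n) k}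
    (hq : q ∈ Submodule.span k (Set.range p)) (ha : eval v a = 0) (hb : eval v b = 0)
    (hqab : q = a * b) : matAct s q = q := by
  have := h.finite_normal
  lift s to Wt using hs
  set M : Matrix (Fin m) (Fin m) k := Matrix.of (c s) with hM
  have hy : M.mulVec (pMap p v) = pMap p v := by
    funext i
    have h1 : eval v (matAct (s : Matrix.GeneralLinearGroup (Fin n) k) (p i)) = eval v (p i) := by
      rw [eval_matAct]
      nth_rw 1 [← hsv]
      rw [mulVec_inv_mulVec]
    rw [h.equivar] at h1
    simpa [M, Matrix.mulVec, dotProduct, pMap, smul_eval] using h1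
  have hev : ∀ F, eval (pMap p v) F = eval v (aeval p F) := by
    intro F
    induction F using MvPolynomial.induction_on with
    | C a => simp
    | add p q hp hq => rw [map_add, map_add, map_add, hp, hq]
    | mul_X p i hp => rw [map_mul, map_mul, map_mul, hp]; simp [pMap]
  let π : MvPolynomial (Fin m) k →ₐ[k] invariants G :=
    (aeval p).codRestrict (invariants G) h.aeval_mem_invariants
  have hπ : Function.Surjective π := fun u => by
    obtain ⟨F, hF⟩ := h.exists_aeval_eq u.2
    exact ⟨F, Subtype.ext hF⟩
  obtain ⟨a', ha'⟩ := (Submodule.mem_span_range_iff_exists_fun k).mp hq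
  have key : ∀ ζ : Fin m → k, a' ⬝ᵥ (ζ - M.mulVec ζ) = 0 := by
    intro ζ
    set φ := tangentEval (pMap p v) (ζ - M.mulVec ζ)
    have hJ : invRelIdeal p c ≤ RingHom.ker φ := by
      refine Ideal.span_le.mpr fun F hF => ?_
      have hF0 : aeval p F = 0 := hF.1
      change φ F = 0
      ext
      · rw [fst_tangentEval, hev, hF0]
        simp
      · have h2 := tangentEval_polyAct (c s) (pMap p v) ζ F
        rw [hF.2 s, ← hM, hy] at h2
        rw [snd_tangentEval_sub, h2, sub_self, TrivSqZeroExt.snd_zero]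
    have hI : ∀ F, π F = 0 → φ F = 0 := by
      intro F hF
      have h2 : φ (r * F) = 0 := hJ (hr F (congrArg Subtype.val hF))
      rw [map_mul] at h2
      have hunit : IsUnit (φ r) := by
        rw [TrivSqZeroExt.isUnit_iff_isUnit_fst, fst_tangentEval]
        exact hrv.isUnit
      exact hunit.mul_right_eq_zero.mp h2
    let ψ : invariants G →ₐ[k] DualNumber k :=
      (Ideal.Quotient.liftₐ (RingHom.ker π) φ hI).comp
        (Ideal.quotientKerAlgEquivOfSurjective hπ).symm.toAlgHom
    have hψ : ∀ F, ψ (π F) = φ F := by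
      intro F
      have : (Ideal.quotientKerAlgEquivOfSurjective hπ).symm (π F)
          = Ideal.Quotient.mk _ F := by
        rw [AlgEquiv.symm_apply_eq]
        rfl
      change (Ideal.Quotient.liftₐ (RingHom.ker π) φ hI)
        ((Ideal.quotientKerAlgEquivOfSurjective hπ).symm (π F)) = _
      rw [this]
      rfl
    have h3 := tangent_eq_zero_of_eq_mul G hv ψ (fun u => by
      obtain ⟨F, rfl⟩ := hπ u
      rw [hψ, fst_tangentEval, hev]
      rfl) (q := π (linForm a')) ha hb (by
        rw [← hqab, ← ha']
        exact aeval_linForm p a')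
    rw [hψ] at h3
    rw [← tangentEval_linForm (pMap p v), h3, TrivSqZeroExt.snd_zero]
  have hfix : a' = fun j => ∑ i, a' i * c s i j := by
    funext j
    have := key (Pi.single j 1)
    rw [dotProduct_sub, sub_eq_zero] at this
    simpa [M, dotProduct, Pi.single_apply] using this
  rw [← ha', ← aeval_linForm, ← h.aeval_polyAct, polyAct_linForm, ← hfix]

end Conormal

/-! ### Pointwise stabilizers of hyperplanes -/

section Hyperplane

variable {n : ℕ}

/-- The hyperplane `H` is the kernel of the nonzero linear form with coefficients `a`. -/
def IsEquation (a : Fin n → k) (H : Submodule k (Fin n → k)) : Prop :=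
  a ≠ 0 ∧ ∀ x, x ∈ H ↔ a ⬝ᵥ x = 0

lemma exists_isEquation {H : Submodule k (Fin n → k)} (hH : Module.finrank k H + 1 = n) :
    ∃ a, IsEquation a H := by
  classical
  have hlt : H < ⊤ := by
    refine lt_top_iff_ne_top.mpr fun h => ?_
    rw [h, finrank_top, Module.finrank_fin_fun] at hH
    omega
  obtain ⟨f, hf, hle⟩ := Submodule.exists_le_ker_of_lt_top H hlt
  have hker := Module.Dual.finrank_ker_add_one_of_ne_zero hf
  rw [Module.finrank_fin_fun] at hker
  have hHf : H = LinearMap.ker f := Submodule.eq_of_le_of_finrank_le hle (by omega)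
  have hfa : ∀ x, f x = (fun i => f fun j => if i = j then 1 else 0) ⬝ᵥ x := by
    intro x
    rw [LinearMap.pi_apply_eq_sum_univ]
    simp [dotProduct, mul_comm]
  refine ⟨fun i => f fun j => if i = j then 1 else 0, fun h0 => hf ?_, fun x => ?_⟩
  · exact LinearMap.ext fun x => by rw [hfa, h0, zero_dotProduct, LinearMap.zero_apply]
  · rw [hHf, LinearMap.mem_ker, hfa]

variable {a : Fin n → k} {H : Submodule k (Fin n → k)}

lemma IsEquation.finrank (ha : IsEquation a H) : Module.finrank k H + 1 = n := by
  let f : Module.Dual k (Fin n → k) :=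
    { toFun := fun x => a ⬝ᵥ x
      map_add' := dotProduct_add a
      map_smul' := fun c x => dotProduct_smul c a x }
  have hf : f ≠ 0 := by
    intro h0
    apply ha.1
    funext i
    simpa [f] using LinearMap.congr_fun h0 (Pi.single i 1)
  have hH : H = LinearMap.ker f := by
    ext x
    exact ha.2 x
  rw [hH, Module.Dual.finrank_ker_add_one_of_ne_zero hf, Module.finrank_fin_fun]

lemma IsEquation.exists_mulVec_eq (ha : IsEquation a H) {u : Matrix.GeneralLinearGroup (Fin n) k}
    (hu : u ∈ pointStab H) :
    ∃ b : Fin n → k, (∀ x, (u : Matrix (Fin n) (Fin n) k).mulVec x = x + (a ⬝ᵥ x) • b) ∧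
      Matrix.det (u : Matrix (Fin n) (Fin n) k) = 1 + a ⬝ᵥ b := by
  obtain ⟨i, hi⟩ := Function.ne_iff.mp ha.1
  set x₀ : Fin n → k := Pi.single i (a i)⁻¹
  have hx₀ : a ⬝ᵥ x₀ = 1 := by simpa [x₀] using mul_inv_cancel₀ hi
  set b := (u : Matrix (Fin n) (Fin n) k).mulVec x₀ - x₀ with hb
  have hub : ∀ x, (u : Matrix (Fin n) (Fin n) k).mulVec x = x + (a ⬝ᵥ x) • b := by
    intro x
    have h1 := hu (x - (a ⬝ᵥ x) • x₀) ((ha.2 _).mpr (by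
      rw [dotProduct_sub, dotProduct_smul, hx₀, smul_eq_mul, mul_one, sub_self]))
    rw [Matrix.mulVec_sub, Matrix.mulVec_smul, sub_eq_iff_eq_add] at h1
    rw [h1, hb, smul_sub]
    abel
  refine ⟨b, hub, ?_⟩
  have : (u : Matrix (Fin n) (Fin n) k)
      = 1 + Matrix.replicateCol Unit b * Matrix.replicateRow Unit a := by
    apply Matrix.toLin'.injective
    refine LinearMap.ext fun x => ?_
    rw [Matrix.toLin'_apply, Matrix.toLin'_apply, hub, Matrix.add_mulVec, Matrix.one_mulVec]
    congr 1
    funext j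
    simp [Matrix.mulVec, dotProduct, Matrix.mul_apply, Finset.sum_mul, mul_comm, mul_left_comm, mul_assoc]
  rw [this, Matrix.det_one_add_replicateCol_mul_replicateRow]

lemma IsEquation.dotProduct_mulVec (ha : IsEquation a H)
    {u : Matrix.GeneralLinearGroup (Fin n) k} (hu : u ∈ pointStab H) (x : Fin n → k) :
    a ⬝ᵥ (u : Matrix (Fin n) (Fin n) k).mulVec x
      = Matrix.det (u : Matrix (Fin n) (Fin n) k) * (a ⬝ᵥ x) := by
  obtain ⟨b, hb, hdet⟩ := ha.exists_mulVec_eq hu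
  rw [hb, hdet, dotProduct_add, dotProduct_smul, smul_eq_mul]
  ring

lemma IsEquation.matAct_linForm [Infinite k] (ha : IsEquation a H)
    {u : Matrix.GeneralLinearGroup (Fin n) k} (hu : u ∈ pointStab H) :
    matAct u (linForm a) = (Matrix.det (u : Matrix (Fin n) (Fin n) k))⁻¹ • linForm a := by
  refine MvPolynomial.funext fun x => ?_
  rw [eval_matAct, smul_eval, eval_linForm, eval_linForm,
    ha.dotProduct_mulVec (inv_mem hu), Matrix.coe_units_inv, Matrix.det_nonsing_inv,
    Ring.inverse_eq_inv']

lemma IsEquation.eq_one_of_det [CharZero k] (ha : IsEquation a H)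
    {u : Matrix.GeneralLinearGroup (Fin n) k} (hu : u ∈ pointStab H) (hfin : IsOfFinOrder u)
    (hdet : Matrix.det (u : Matrix (Fin n) (Fin n) k) = 1) : u = 1 := by
  obtain ⟨b, hb, hdet'⟩ := ha.exists_mulVec_eq hu
  have hab : a ⬝ᵥ b = 0 := by simpa [hdet'] using hdet
  have hpow : ∀ (j : ℕ) (x : Fin n → k),
      (↑(u ^ j) : Matrix (Fin n) (Fin n) k).mulVec x = x + (j : k) • (a ⬝ᵥ x) • b := by
    intro j x
    induction j with
    | zero => simp
    | succ j ih =>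
      rw [pow_succ', Units.val_mul, ← Matrix.mulVec_mulVec, ih, hb, dotProduct_add,
        dotProduct_smul, dotProduct_smul, hab, smul_zero, smul_zero, add_zero, Nat.cast_succ,
        add_smul, one_smul, add_assoc]
  refine eq_one_of_fixedSpace_eq_top (eq_top_iff.mpr fun x _ => mem_fixedSpace.mpr ?_)
  have h1 := hpow (orderOf u) x
  rw [pow_orderOf_eq_one, Units.val_one, Matrix.one_mulVec, left_eq_add, smul_eq_zero] at h1
  rw [hb, h1.resolve_left (Nat.cast_ne_zero.mpr hfin.orderOf_pos.ne'), add_zero]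

lemma IsEquation.fixedSpace_eq (ha : IsEquation a H)
    {u : Matrix.GeneralLinearGroup (Fin n) k} (hu : u ∈ pointStab H) (hu1 : u ≠ 1) :
    fixedSpace (u : Matrix (Fin n) (Fin n) k) = H := by
  obtain ⟨b, hb, -⟩ := ha.exists_mulVec_eq hu
  have hb0 : b ≠ 0 := by
    rintro rfl
    refine hu1 (eq_one_of_fixedSpace_eq_top (eq_top_iff.mpr fun x _ => mem_fixedSpace.mpr ?_))
    rw [hb, smul_zero, add_zero]
  ext x
  rw [mem_fixedSpace, hb, add_eq_left, smul_eq_zero, or_iff_left hb0, ha.2]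

lemma IsEquation.isReflection (ha : IsEquation a H)
    {u : Matrix.GeneralLinearGroup (Fin n) k} (hu : u ∈ pointStab H) (hfin : IsOfFinOrder u)
    (hu1 : u ≠ 1) : IsReflection (u : Matrix (Fin n) (Fin n) k) := by
  refine ⟨Units.isOfFinOrder_val.mpr hfin, ?_⟩
  have h := ha.fixedSpace_eq hu hu1
  rw [fixedSpace] at h
  rw [h, ha.finrank]

lemma exists_dvd_pow_of_eval_eq_zero [IsAlgClosed k] {l f : MvPolynomial (Fin n) k}
    (hf : ∀ x, eval x l = 0 → eval x f = 0) : ∃ N : ℕ, l ∣ f ^ N := by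
  have h : f ∈ vanishingIdeal k (zeroLocus k (Ideal.span {l})) := by
    rw [mem_vanishingIdeal_iff]
    intro x hx
    rw [mem_zeroLocus_iff] at hx
    exact hf x (hx l (Ideal.mem_span_singleton_self l))
  rw [vanishingIdeal_zeroLocus_eq_radical] at h
  obtain ⟨N, hN⟩ := h
  exact ⟨N, Ideal.mem_span_singleton.mp hN⟩

lemma prime_linForm (ha : a ≠ 0) : Prime (linForm a) := (irreducible_linForm ha).prime

lemma IsEquation.linForm_dvd [IsAlgClosed k] (ha : IsEquation a H) {f : MvPolynomial (Fin n) k}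
    (hf : ∀ x ∈ H, eval x f = 0) : linForm a ∣ f := by
  obtain ⟨N, hN⟩ := exists_dvd_pow_of_eval_eq_zero (l := linForm a) (f := f) fun x hx =>
    hf x ((ha.2 x).mpr (by rwa [eval_linForm] at hx))
  exact (prime_linForm ha.1).dvd_of_dvd_pow hN

lemma IsEquation.linForm_dvd_matAct_sub [IsAlgClosed k] (ha : IsEquation a H)
    {u : Matrix.GeneralLinearGroup (Fin n) k} (hu : u ∈ pointStab H)
    (f : MvPolynomial (Fin n) k) : linForm a ∣ matAct u f - f := by
  refine ha.linForm_dvd fun x hx => ?_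
  rw [map_sub, eval_matAct, inv_mem hu x hx, sub_self]

variable {Wt : Subgroup (Matrix.GeneralLinearGroup (Fin n) k)}

lemma exists_isEquation_of_mem_reflHyps (hH : H ∈ reflHyps Wt) : ∃ a, IsEquation a H := by
  obtain ⟨g, -, hg, rfl⟩ := hH
  exact exists_isEquation hg.2

end Hyperplane

/-! ### The eigenvectors of reflections on the space of generators -/

section Root

variable {n m : ℕ} {Wt G : Subgroup (Matrix.GeneralLinearGroup (Fin n) k)}
  {p : Fin m → MvPolynomial (Fin n) k} {d : Fin m → ℕ} {c : ↥Wt → Fin m → Fin m → k}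
  {a : Fin n → k} {H : Submodule k (Fin n → k)}

lemma QuotSetup.isOfFinOrder (h : QuotSetup Wt G p d c)
    {w : Matrix.GeneralLinearGroup (Fin n) k} (hw : w ∈ Wt) : IsOfFinOrder w := by
  have := h.finite_coe
  exact Submonoid.isOfFinOrder_coe.mpr (isOfFinOrder_of_finite (⟨w, hw⟩ : Wt))

lemma QuotSetup.eq_one_of_mem (h : QuotSetup Wt G p d c)
    (hG : ∀ g ∈ G, ¬ IsReflection (g : Matrix (Fin n) (Fin n) k)) (ha : IsEquation a H)
    {g : Matrix.GeneralLinearGroup (Fin n) k} (hg : g ∈ G) (hgH : g ∈ pointStab H) : g = 1 := by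
  by_contra h1
  exact hG g hg (ha.isReflection hgH (h.isOfFinOrder (h.le hg)) h1)

lemma QuotSetup.exists_trivial_stabilizer [Infinite k] (h : QuotSetup Wt G p d c)
    (hG : ∀ g ∈ G, ¬ IsReflection (g : Matrix (Fin n) (Fin n) k)) (ha : IsEquation a H) :
    ∃ v ∈ H, ∀ g ∈ G, (g : Matrix (Fin n) (Fin n) k).mulVec v = v → g = 1 := by
  have := h.finite_normal
  by_contra! hcov
  obtain ⟨⟨⟨g, hg⟩, hg1⟩, hle⟩ := exists_le_of_forall_mem H
    (fun g : {g : G // (g : Matrix.GeneralLinearGroup (Fin n) k) ≠ 1} =>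
      fixedSpace ((g : Matrix.GeneralLinearGroup (Fin n) k) : Matrix (Fin n) (Fin n) k)) (by
    intro x hx
    obtain ⟨g, hg, hgx, hg1⟩ := hcov x hx
    exact ⟨⟨⟨g, hg⟩, hg1⟩, mem_fixedSpace.mpr hgx⟩)
  exact hg1 (h.eq_one_of_mem hG ha hg fun x hx => mem_fixedSpace.mp (hle hx))

lemma QuotSetup.eval_zero_generator (h : QuotSetup Wt G p d c) (i : Fin m) :
    eval 0 (p i) = 0 := by
  rw [eval_zero, constantCoeff_eq]
  refine (h.homog i).coeff_eq_zero ?_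
  rw [map_zero]
  exact (h.dpos i).ne

lemma exists_smul_eval_ne_zero [Infinite k] (p : Fin m → MvPolynomial (Fin n) k)
    (r : MvPolynomial (Fin m) k) (v : Fin n → k) (h0 : eval (pMap p 0) r ≠ 0) :
    ∃ t : k, t ≠ 0 ∧ eval (pMap p (t • v)) r ≠ 0 := by
  let F : Polynomial k :=
    aeval (fun i => aeval (fun j => Polynomial.C (v j) * Polynomial.X) (p i)) r
  have hF : ∀ t, F.eval t = eval (pMap p (t • v)) r := by
    intro t
    have h1 : ∀ i, (aeval (fun j => Polynomial.C (v j) * Polynomial.X) (p i) : Polynomial k).eval t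
        = pMap p (t • v) i := by
      intro i
      rw [← Polynomial.coe_aeval_eq_eval, pMap, ← AlgHom.comp_apply, comp_aeval, ← coe_aeval_eq_eval]
      have h2 : (fun j => (Polynomial.aeval t) (Polynomial.C (v j) * Polynomial.X)) = t • v := by
        funext j
        rw [Polynomial.coe_aeval_eq_eval, Polynomial.eval_mul, Polynomial.eval_C, Polynomial.eval_X,
          mul_comm]
        rfl
      rw [h2]
      rfl
    rw [← Polynomial.coe_aeval_eq_eval, ← AlgHom.comp_apply, comp_aeval, ← coe_aeval_eq_eval]
    simp only [Polynomial.coe_aeval_eq_eval, h1]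
    rfl
  by_contra! hall
  have hXF : Polynomial.X * F = 0 := by
    refine Polynomial.funext fun t => ?_
    rw [Polynomial.eval_mul, Polynomial.eval_X, Polynomial.eval_zero, hF, mul_eq_zero]
    by_cases ht : t = 0
    · exact Or.inl ht
    · exact Or.inr (hall t ht)
  have h1 := hF 0
  rw [(mul_eq_zero.mp hXF).resolve_left Polynomial.X_ne_zero, Polynomial.eval_zero, zero_smul] at h1
  exact h0 h1.symm

lemma QuotSetup.matAct_mem_span (h : QuotSetup Wt G p d c)
    {w : Matrix.GeneralLinearGroup (Fin n) k} (hw : w ∈ Wt) {q : MvPolynomial (Fin n) k}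
    (hq : q ∈ Submodule.span k (Set.range p)) :
    matAct w q ∈ Submodule.span k (Set.range p) := by
  refine (Submodule.map_span_le (matAct w).toLinearMap _ _).mpr ?_
    (Submodule.mem_map_of_mem (f := (matAct w).toLinearMap) hq)
  rintro _ ⟨i, rfl⟩
  change matAct w (p i) ∈ _
  rw [h.equivar ⟨w, hw⟩ i]
  exact Submodule.sum_mem _ fun j _ => Submodule.smul_mem _ _ (Submodule.subset_span ⟨j, rfl⟩)

/-- A point of a reflecting hyperplane at which differences `t • q - q` are detected
to first order. -/
lemma QuotSetup.exists_generic_point [CharZero k] (h : QuotSetup Wt G p d c)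
    (htriv : TrivialConormal Wt p c)
    (hG : ∀ g ∈ G, ¬ IsReflection (g : Matrix (Fin n) (Fin n) k)) (ha : IsEquation a H) :
    ∃ v ∈ H, ∀ t ∈ Wt ⊓ pointStab H, ∀ q ∈ Submodule.span k (Set.range p), ∀ b,
      matAct t q = q + linForm a * b → eval v b = 0 → b = 0 := by
  obtain ⟨r, hr0, hr⟩ := h.exists_mul_mem_invRelIdeal htriv
  obtain ⟨v, hvH, hv⟩ := h.exists_trivial_stabilizer hG ha
  have hp0 : pMap p 0 = 0 := funext h.eval_zero_generator
  obtain ⟨t, ht, htr⟩ := exists_smul_eval_ne_zero p r v (by rw [hp0, hr0]; exact one_ne_zero)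
  have htv : t • v ∈ H := H.smul_mem t hvH
  refine ⟨t • v, htv, fun s hs q hq b hqb hb => ?_⟩
  have hstab : ∀ g ∈ G, (g : Matrix (Fin n) (Fin n) k).mulVec (t • v) = t • v → g = 1 := by
    intro g hg hgv
    rw [Matrix.mulVec_smul] at hgv
    exact hv g hg (smul_right_injective _ ht hgv)
  have hmem : linForm a * b ∈ Submodule.span k (Set.range p) := by
    have h1 := Submodule.sub_mem _ (h.matAct_mem_span hs.1 hq) hq
    rwa [hqb, add_sub_cancel_left] at h1
  have hfix := h.matAct_eq_self_of_eq_mul hr hstab htr hs.1 (hs.2 _ htv) hmem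
    (by rw [eval_linForm]; exact (ha.2 _).mp htv) hb rfl
  exact (mul_eq_zero.mp (matAct_eq_self_of_sub_fixed (h.isOfFinOrder hs.1) hqb hfix)).resolve_left
    (linForm_ne_zero ha.1)

lemma QuotSetup.span_le_invariants (h : QuotSetup Wt G p d c) {q : MvPolynomial (Fin n) k}
    (hq : q ∈ Submodule.span k (Set.range p)) : q ∈ invariants G := by
  rw [← h.gen]
  exact Algebra.span_le_adjoin k _ hq

/-- An element fixing the span of the generators lies in `G`. -/
lemma QuotSetup.mem_of_fixes_span [CharZero k] (h : QuotSetup Wt G p d c)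
    {w : Matrix.GeneralLinearGroup (Fin n) k} (hw : w ∈ Wt)
    (hfix : ∀ q ∈ Submodule.span k (Set.range p), matAct w q = q) : w ∈ G := by
  have := h.finite_coe
  refine mem_of_fixes_invariants h.le hw fun b hb => ?_
  obtain ⟨F, rfl⟩ := h.exists_aeval_eq hb
  rw [← AlgHom.comp_apply]
  congr 1
  refine algHom_ext fun i => ?_
  simpa using hfix (p i) (Submodule.subset_span ⟨i, rfl⟩)

/-- `s` acts on the span of the `p i` as the identity plus a rank one map with image spanned
by `l`. -/
structure IsRoot (p : Fin m → MvPolynomial (Fin n) k) (s : Matrix.GeneralLinearGroup (Fin n) k)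
    (l : MvPolynomial (Fin n) k) : Prop where
  mem : l ∈ Submodule.span k (Set.range p)
  ne_zero : l ≠ 0
  jump : ∃ q ∈ Submodule.span k (Set.range p), matAct s q = q + l
  exists_smul : ∀ q ∈ Submodule.span k (Set.range p), ∃ μ : k, matAct s q = q + μ • l

lemma IsRoot.congr {s t : Matrix.GeneralLinearGroup (Fin n) k} {l : MvPolynomial (Fin n) k}
    (hl : IsRoot p s l) (hst : ∀ q ∈ Submodule.span k (Set.range p), matAct t q = matAct s q) :
    IsRoot p t l := by
  obtain ⟨q, hq, hql⟩ := hl.jump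
  refine ⟨hl.mem, hl.ne_zero, ⟨q, hq, by rw [hst q hq, hql]⟩, fun q hq => ?_⟩
  rw [hst q hq]
  exact hl.exists_smul q hq

lemma QuotSetup.isRoot_not_sq_dvd [CharZero k] (h : QuotSetup Wt G p d c) (htriv : TrivialConormal Wt p c)
    (hG : ∀ g ∈ G, ¬ IsReflection (g : Matrix (Fin n) (Fin n) k)) (ha : IsEquation a H)
    {s : Matrix.GeneralLinearGroup (Fin n) k} (hs : s ∈ Wt ⊓ pointStab H)
    {l : MvPolynomial (Fin n) k} (hl : IsRoot p s l) : ¬ linForm a * linForm a ∣ l := by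
  rintro ⟨b, hb⟩
  obtain ⟨v, hvH, hv⟩ := h.exists_generic_point htriv hG ha
  obtain ⟨q, hq, hql⟩ := hl.jump
  have := hv s hs q hq (linForm a * b) (by rw [hql, hb, mul_assoc])
    (by rw [map_mul, eval_linForm, (ha.2 v).mp hvH, zero_mul])
  exact hl.ne_zero (by rw [hb, mul_assoc, this, mul_zero])

variable [CharZero k] [IsAlgClosed k]

lemma QuotSetup.exists_isRoot (h : QuotSetup Wt G p d c) (htriv : TrivialConormal Wt p c)
    (hG : ∀ g ∈ G, ¬ IsReflection (g : Matrix (Fin n) (Fin n) k)) (ha : IsEquation a H)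
    {s : Matrix.GeneralLinearGroup (Fin n) k} (hs : s ∈ Wt ⊓ pointStab H) (hs1 : s ≠ 1) :
    ∃ l, IsRoot p s l := by
  obtain ⟨v, hvH, hv⟩ := h.exists_generic_point htriv hG ha
  obtain ⟨q₀, hq₀, hne⟩ : ∃ q ∈ Submodule.span k (Set.range p), matAct s q ≠ q := by
    by_contra! hfix
    exact hs1 (h.eq_one_of_mem hG ha (h.mem_of_fixes_span hs.1 hfix) hs.2)
  obtain ⟨b₀, hb₀⟩ := ha.linForm_dvd_matAct_sub hs.2 q₀
  have hb₀v : eval v b₀ ≠ 0 := by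
    intro h0
    have := hv s hs q₀ hq₀ b₀ (by rw [← hb₀, add_sub_cancel]) h0
    rw [this, mul_zero, sub_eq_zero] at hb₀
    exact hne hb₀
  refine ⟨matAct s q₀ - q₀, Submodule.sub_mem _ (h.matAct_mem_span hs.1 hq₀) hq₀,
    sub_ne_zero.mpr hne, ⟨q₀, hq₀, by rw [add_sub_cancel]⟩, fun q hq => ?_⟩
  obtain ⟨b, hb⟩ := ha.linForm_dvd_matAct_sub hs.2 q
  set μ := eval v b / eval v b₀ with hμ
  refine ⟨μ, ?_⟩
  have h1 := hv s hs (q - μ • q₀) (Submodule.sub_mem _ hq (Submodule.smul_mem _ _ hq₀))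
    (b - μ • b₀) (by
      rw [mul_sub, mul_smul_comm, ← hb, ← hb₀, map_sub, map_smul, smul_sub]
      ring) (by
      rw [map_sub, smul_eval, hμ, div_mul_cancel₀ _ hb₀v, sub_self])
  rw [sub_eq_zero] at h1
  rw [hb₀, ← mul_smul_comm, ← h1, ← hb, add_sub_cancel]

lemma QuotSetup.matAct_isRoot (h : QuotSetup Wt G p d c) (htriv : TrivialConormal Wt p c)
    (hG : ∀ g ∈ G, ¬ IsReflection (g : Matrix (Fin n) (Fin n) k)) (ha : IsEquation a H)
    {s : Matrix.GeneralLinearGroup (Fin n) k} (hs : s ∈ Wt ⊓ pointStab H)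
    {l : MvPolynomial (Fin n) k} (hl : IsRoot p s l) :
    matAct s l = (Matrix.det (s : Matrix (Fin n) (Fin n) k))⁻¹ • l := by
  obtain ⟨v, hvH, hv⟩ := h.exists_generic_point htriv hG ha
  obtain ⟨q, hq, hql⟩ := hl.jump
  obtain ⟨b, hb⟩ := ha.linForm_dvd_matAct_sub hs.2 q
  rw [hql, add_sub_cancel_left] at hb
  have hbv : eval v b ≠ 0 := by
    intro h0
    refine hl.ne_zero ?_
    rw [hb, hv s hs q hq b (by rw [hql, hb]) h0, mul_zero]
  obtain ⟨μ, hμ⟩ := hl.exists_smul l hl.mem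
  have h1 : linForm a * ((Matrix.det (s : Matrix (Fin n) (Fin n) k))⁻¹ • matAct s b)
      = linForm a * (b + μ • b) := by
    rw [mul_smul_comm, ← smul_mul_assoc, ← ha.matAct_linForm hs.2, ← map_mul, ← hb, hμ, mul_add,
      mul_smul_comm, ← hb]
  have h2 := congrArg (eval v) (mul_left_cancel₀ (linForm_ne_zero ha.1) h1)
  rw [smul_eval, eval_matAct, (pointStab H).inv_mem hs.2 v hvH, map_add, smul_eval, ← one_add_mul] at h2
  rw [mul_right_cancel₀ hbv h2, add_smul, one_smul, hμ]

end Root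

/-! ### Zeros of roots -/

section Zeros

variable {n m : ℕ} {Wt G : Subgroup (Matrix.GeneralLinearGroup (Fin n) k)}
  {p : Fin m → MvPolynomial (Fin n) k} {d : Fin m → ℕ} {c : ↥Wt → Fin m → Fin m → k}
  {a : Fin n → k} {H : Submodule k (Fin n → k)}
  {s : Matrix.GeneralLinearGroup (Fin n) k} {l : MvPolynomial (Fin n) k}

lemma IsEquation.mem_reflHyps (h : QuotSetup Wt G p d c) (ha : IsEquation a H)
    (hs : s ∈ Wt ⊓ pointStab H) (hs1 : s ≠ 1) : H ∈ reflHyps Wt :=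
  ⟨s, hs.1, ha.isReflection hs.2 (h.isOfFinOrder hs.1) hs1, (ha.fixedSpace_eq hs.2 hs1).symm⟩

lemma IsRoot.exists_pow (hl : IsRoot p s l) {χ : k} (hχ : matAct s l = χ • l) [Infinite k] (j : ℕ)
    {q : MvPolynomial (Fin n) k} (hq : q ∈ Submodule.span k (Set.range p)) :
    ∃ μ : k, matAct (s ^ j) q = q + μ • l := by
  induction j with
  | zero => exact ⟨0, by simp [matAct_one]⟩
  | succ j ih =>
    obtain ⟨μ, hμ⟩ := ih
    obtain ⟨ν, hν⟩ := hl.exists_smul q hq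
    refine ⟨ν + μ * χ, ?_⟩
    rw [pow_succ', matAct_mul, hμ, map_add, map_smul, hν, hχ, smul_smul, add_smul, add_assoc]

variable [CharZero k]

lemma IsRoot.mul_right (h : QuotSetup Wt G p d c) (hl : IsRoot p s l)
    {g : Matrix.GeneralLinearGroup (Fin n) k} (hg : g ∈ G) : IsRoot p (s * g) l :=
  hl.congr fun q hq => by rw [matAct_mul, h.span_le_invariants hq g hg]

lemma IsRoot.exists_mulVec_eq (h : QuotSetup Wt G p d c) (hl : IsRoot p s l) {x : Fin n → k}
    (hx : eval x l = 0) :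
    ∃ g ∈ G, (↑(s * g) : Matrix (Fin n) (Fin n) k).mulVec x = x := by
  have := h.finite_normal
  have hp : ∀ i, eval ((↑(s⁻¹) : Matrix (Fin n) (Fin n) k).mulVec x) (p i) = eval x (p i) := by
    intro i
    obtain ⟨μ, hμ⟩ := hl.exists_smul (p i) (Submodule.subset_span ⟨i, rfl⟩)
    rw [← eval_matAct, hμ, map_add, smul_eval, hx, mul_zero, add_zero]
  obtain ⟨g, hg, hgx⟩ := exists_mulVec_eq_of_eval_invariants_eq G
    (x := x) (y := (↑(s⁻¹) : Matrix (Fin n) (Fin n) k).mulVec x) (fun b hb => by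
      obtain ⟨F, rfl⟩ := h.exists_aeval_eq hb
      induction F using MvPolynomial.induction_on with
      | C a => simp
      | add P Q hP hQ =>
        simp only [map_add, hP (h.aeval_mem_invariants P), hQ (h.aeval_mem_invariants Q)]
      | mul_X P i hP =>
        simp only [map_mul, hP (h.aeval_mem_invariants P), aeval_X, hp])
  exact ⟨g, hg, by rw [Units.val_mul, ← Matrix.mulVec_mulVec, ← hgx, mulVec_mulVec_inv]⟩

lemma IsRoot.exists_mem_pointStab (h : QuotSetup Wt G p d c) (hl : IsRoot p s l)
    {L : Submodule k (Fin n → k)} (hL : ∀ x ∈ L, eval x l = 0) :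
    ∃ g ∈ G, s * g ∈ pointStab L := by
  have := h.finite_normal
  obtain ⟨g, hg⟩ := exists_le_of_forall_mem L
    (fun g : G => fixedSpace (↑(s * g) : Matrix (Fin n) (Fin n) k)) (fun x hx => by
      obtain ⟨g, hg, hgx⟩ := hl.exists_mulVec_eq h (hL x hx)
      exact ⟨⟨g, hg⟩, mem_fixedSpace.mpr hgx⟩)
  exact ⟨g, g.2, fun x hx => mem_fixedSpace.mp (hg hx)⟩

variable [IsAlgClosed k]

/-- The irreducible factors of a root are linear forms. -/
lemma IsRoot.exists_associated_linForm (h : QuotSetup Wt G p d c) (hl : IsRoot p s l)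
    (hsG : s ∉ G) {π : MvPolynomial (Fin n) k} (hπ : Irreducible π) (hπl : π ∣ l) :
    ∃ (a : Fin n → k) (H : Submodule k (Fin n → k)), IsEquation a H ∧ Associated π (linForm a) ∧
      ∀ x ∈ H, eval x l = 0 := by
  have := h.finite_normal
  have := Fintype.ofFinite G
  have hrow : ∀ g : G, ∃ i,
      ((↑(s * g) : Matrix (Fin n) (Fin n) k) - 1) i ≠ 0 := by
    intro g
    by_contra! hall
    have h1 : s * g = 1 := Units.ext (sub_eq_zero.mp (funext hall))
    exact hsG (eq_inv_of_mul_eq_one_left h1 ▸ G.inv_mem g.2)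
  choose i hi using hrow
  have hdvd : π ∣ ∏ g : G, linForm (((↑(s * g) : Matrix (Fin n) (Fin n) k) - 1) (i g)) := by
    obtain ⟨N, hN⟩ := exists_dvd_pow_of_eval_eq_zero (l := π)
      (f := ∏ g : G, linForm (((↑(s * g) : Matrix (Fin n) (Fin n) k) - 1) (i g)))
      (fun x hx => by
        obtain ⟨b, rfl⟩ := hπl
        obtain ⟨g, hg, hgx⟩ := hl.exists_mulVec_eq h (x := x) (by rw [map_mul, hx, zero_mul])
        rw [map_prod]
        refine Finset.prod_eq_zero (Finset.mem_univ ⟨g, hg⟩) ?_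
        rw [eval_linForm]
        change (((↑(s * g) : Matrix (Fin n) (Fin n) k) - 1).mulVec x) _ = 0
        rw [Matrix.sub_mulVec, hgx, Matrix.one_mulVec, sub_self, Pi.zero_apply])
    exact hπ.prime.dvd_of_dvd_pow hN
  obtain ⟨g, -, hg⟩ := (hπ.prime.dvd_finsetProd_iff _).mp hdvd
  set a := ((↑(s * g) : Matrix (Fin n) (Fin n) k) - 1) (i g)
  have hassoc := hπ.associated_of_dvd (irreducible_linForm (hi g)) hg
  refine ⟨a, LinearMap.ker (dotProductBilin k k a), ⟨hi g, fun x => LinearMap.mem_ker⟩, hassoc,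
    fun x hx => ?_⟩
  obtain ⟨b, rfl⟩ := hassoc.symm.dvd.trans hπl
  rw [map_mul, eval_linForm]
  exact mul_eq_zero_of_left hx _

lemma IsRoot.squarefree (h : QuotSetup Wt G p d c) (htriv : TrivialConormal Wt p c)
    (hG : ∀ g ∈ G, ¬ IsReflection (g : Matrix (Fin n) (Fin n) k)) (hs : s ∈ Wt) (hsG : s ∉ G)
    (hl : IsRoot p s l) : Squarefree l := by
  rw [squarefree_iff_irreducible_sq_not_dvd_of_ne_zero hl.ne_zero]
  intro π hπ hdvd
  obtain ⟨a, H, ha, hassoc, hH⟩ := hl.exists_associated_linForm h hsG hπ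
    ((dvd_mul_right π π).trans hdvd)
  obtain ⟨g, hg, hsg⟩ := hl.exists_mem_pointStab h hH
  exact h.isRoot_not_sq_dvd htriv hG ha ⟨Wt.mul_mem hs (h.le hg), hsg⟩ (hl.mul_right h hg)
    ((hassoc.mul_mul hassoc).symm.dvd.trans hdvd)

end Zeros

/-! ### Distinguished generators -/

section Distinguished

variable {n m : ℕ} {Wt G : Subgroup (Matrix.GeneralLinearGroup (Fin n) ℂ)}
  {p : Fin m → MvPolynomial (Fin n) ℂ} {d : Fin m → ℕ} {c : ↥Wt → Fin m → Fin m → ℂ}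
  {a : Fin n → ℂ} {H H' : Submodule ℂ (Fin n → ℂ)}
  {s s' : Matrix.GeneralLinearGroup (Fin n) ℂ} {l : MvPolynomial (Fin n) ℂ}

/-- The determinant on a subgroup of `GL_n(k)`. -/
def detHom (K : Subgroup (Matrix.GeneralLinearGroup (Fin n) ℂ)) : K →* ℂ :=
  (Matrix.detMonoidHom.comp (Units.coeHom _)).comp K.subtype

lemma QuotSetup.detHom_injective (h : QuotSetup Wt G p d c) (ha : IsEquation a H) :
    Function.Injective (detHom (Wt ⊓ pointStab H)) := by
  rw [injective_iff_map_eq_one]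
  intro u hu
  exact Subtype.ext (ha.eq_one_of_det u.2.2 (h.isOfFinOrder u.2.1) hu)

lemma QuotSetup.finite_inf (h : QuotSetup Wt G p d c) (K : Subgroup _) :
    Finite (Wt ⊓ K : Subgroup (Matrix.GeneralLinearGroup (Fin n) ℂ)) :=
  h.finite.subset inf_le_left

lemma QuotSetup.isPrimitiveRoot_exp (h : QuotSetup Wt G p d c)
    (H : Submodule ℂ (Fin n → ℂ)) :
    IsPrimitiveRoot (Complex.exp (2 * Real.pi * Complex.I / (Nat.card ↥(Wt ⊓ pointStab H))))
      (Nat.card ↥(Wt ⊓ pointStab H)) := by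
  have := h.finite_inf (pointStab H)
  exact Complex.isPrimitiveRoot_exp _ Nat.card_pos.ne'

lemma detHom_pow_card (u : ↥(Wt ⊓ pointStab H)) :
    detHom _ u ^ Nat.card ↥(Wt ⊓ pointStab H) = 1 := by
  rw [← map_pow, pow_card_eq_one', map_one]

lemma QuotSetup.exists_distinguishedGen (h : QuotSetup Wt G p d c) (ha : IsEquation a H) :
    ∃ s, distinguishedGen Wt H s := by
  have := h.finite_inf (pointStab H)
  have hinj := h.detHom_injective ha
  have : NeZero (Nat.card ↥(Wt ⊓ pointStab H)) := ⟨Nat.card_pos.ne'⟩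
  have hexp := h.isPrimitiveRoot_exp H
  have hcyc : IsCyclic ↥(Wt ⊓ pointStab H) := isCyclic_of_injective_ringHom _ hinj
  obtain ⟨g, hg⟩ := hcyc.exists_generator
  have hprim : IsPrimitiveRoot (detHom _ g) (Nat.card ↥(Wt ⊓ pointStab H)) := by
    rw [← orderOf_eq_card_of_forall_mem_zpowers hg, ← orderOf_injective _ hinj]
    exact IsPrimitiveRoot.orderOf _
  obtain ⟨i, -, hi⟩ := hprim.eq_pow_of_pow_eq_one hexp.pow_eq_one
  refine ⟨↑(g ^ i), (g ^ i).2, fun u hu => ?_, ((map_pow (detHom _) g i).trans hi)⟩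
  rw [← hi] at hexp
  obtain ⟨j, -, hj⟩ := hexp.eq_pow_of_pow_eq_one (detHom_pow_card ⟨u, hu⟩)
  rw [← map_pow, ← map_pow] at hj
  exact ⟨j, by simpa using congrArg Subtype.val (hinj hj)⟩

lemma QuotSetup.eq_of_distinguishedGen (h : QuotSetup Wt G p d c) (ha : IsEquation a H)
    (hs : distinguishedGen Wt H s) {u : Matrix.GeneralLinearGroup (Fin n) ℂ}
    (hu : u ∈ Wt ⊓ pointStab H) (hdet : Matrix.det (u : Matrix (Fin n) (Fin n) ℂ)
      = Complex.exp (2 * Real.pi * Complex.I / (Nat.card ↥(Wt ⊓ pointStab H)))) : u = s :=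
  congrArg Subtype.val (h.detHom_injective ha
    (a₁ := ⟨u, hu⟩) (a₂ := ⟨s, hs.1⟩) (hdet.trans hs.2.2.symm))

lemma distinguishedGen.ne_one (hs : distinguishedGen Wt H s) (hH : H ∈ reflHyps Wt) : s ≠ 1 := by
  rintro rfl
  obtain ⟨g, hg, hgr, rfl⟩ := hH
  have hg1 := hs.2.1 g ⟨hg, fun x hx => mem_fixedSpace.mp hx⟩
  rw [Subgroup.zpowers_one_eq_bot, Subgroup.mem_bot] at hg1
  have h2 := hgr.2
  rw [hg1, Units.val_one, Matrix.toLin'_one, sub_self, LinearMap.ker_zero, finrank_top,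
    Module.finrank_fin_fun] at h2
  omega

lemma distinguishedGen.not_mem (hs : distinguishedGen Wt H s) (hH : H ∈ reflHyps Wt)
    (h : QuotSetup Wt G p d c)
    (hG : ∀ g ∈ G, ¬ IsReflection (g : Matrix (Fin n) (Fin n) ℂ)) : s ∉ G := by
  obtain ⟨a, ha⟩ := exists_isEquation_of_mem_reflHyps hH
  exact fun hsG => hs.ne_one hH (h.eq_one_of_mem hG ha hsG hs.1.2)

/-- The preimage in `Wt` of the image in `Wt/G` of the pointwise stabilizer of `H`. -/
def imageSubgroup (h : QuotSetup Wt G p d c) (H : Submodule ℂ (Fin n → ℂ)) :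
    Subgroup (Matrix.GeneralLinearGroup (Fin n) ℂ) where
  carrier := {x | ∃ g ∈ G, ∃ u ∈ Wt ⊓ pointStab H, x = g * u}
  one_mem' := ⟨1, one_mem _, 1, one_mem _, (one_mul 1).symm⟩
  mul_mem' := by
    rintro _ _ ⟨g, hg, u, hu, rfl⟩ ⟨g', hg', u', hu', rfl⟩
    exact ⟨g * (u * g' * u⁻¹), G.mul_mem hg (h.normal u hu.1 g' hg'), u * u', mul_mem hu hu',
      by group⟩
  inv_mem' := by
    rintro _ ⟨g, hg, u, hu, rfl⟩
    refine ⟨u⁻¹ * g⁻¹ * u⁻¹⁻¹, h.normal u⁻¹ (Wt.inv_mem hu.1) _ (G.inv_mem hg), u⁻¹, inv_mem hu,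
      by group⟩

lemma imageEq_iff (h : QuotSetup Wt G p d c) :
    imageEq Wt G H H' ↔ imageSubgroup h H = imageSubgroup h H' :=
  SetLike.coe_set_eq (p := imageSubgroup h H) (q := imageSubgroup h H')

lemma le_imageSubgroup (h : QuotSetup Wt G p d c) : G ≤ imageSubgroup h H :=
  fun g hg => ⟨g, hg, 1, one_mem _, (mul_one g).symm⟩

lemma inf_pointStab_le_imageSubgroup (h : QuotSetup Wt G p d c) :
    Wt ⊓ pointStab H ≤ imageSubgroup h H :=
  fun u hu => ⟨1, one_mem _, u, hu, (one_mul u).symm⟩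

lemma distinguishedGen.imageSubgroup_le (hs : distinguishedGen Wt H s)
    (h : QuotSetup Wt G p d c) (hsH' : s ∈ imageSubgroup h H') :
    imageSubgroup h H ≤ imageSubgroup h H' := by
  rintro _ ⟨g, hg, u, hu, rfl⟩
  exact mul_mem (le_imageSubgroup h hg)
    ((Subgroup.zpowers_le.mpr hsH') (hs.2.1 u hu))

/-- Distinguished generators with the same image up to the pointwise stabilizers of the
hyperplanes have the same determinant. -/
lemma QuotSetup.exists_mul_eq (h : QuotSetup Wt G p d c) (htriv : TrivialConormal Wt p c)
    (hG : ∀ g ∈ G, ¬ IsReflection (g : Matrix (Fin n) (Fin n) ℂ))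
    (hH : H ∈ reflHyps Wt) (hH' : H' ∈ reflHyps Wt) (himg : imageEq Wt G H H')
    (hs' : distinguishedGen Wt H' s') :
    ∃ g ∈ G, ∃ u ∈ Wt ⊓ pointStab H, s' = g * u ∧
      Matrix.det (u : Matrix (Fin n) (Fin n) ℂ)
        = Complex.exp (2 * Real.pi * Complex.I / (Nat.card ↥(Wt ⊓ pointStab H'))) := by
  obtain ⟨a, ha⟩ := exists_isEquation_of_mem_reflHyps hH
  obtain ⟨a', ha'⟩ := exists_isEquation_of_mem_reflHyps hH'
  have hmem : s' ∈ imageSubgroup h H := by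
    rw [(imageEq_iff h).mp himg]
    exact inf_pointStab_le_imageSubgroup h hs'.1
  obtain ⟨g, hg, u, hu, hgu⟩ := hmem
  refine ⟨g, hg, u, hu, hgu, ?_⟩
  have hu1 : u ≠ 1 := by
    rintro rfl
    exact hs'.not_mem hH' h hG (by rwa [hgu, mul_one])
  obtain ⟨l, hl⟩ := h.exists_isRoot htriv hG ha hu hu1
  have hact : ∀ q ∈ Submodule.span ℂ (Set.range p), matAct s' q = matAct u q := fun q hq => by
    rw [hgu, matAct_mul, h.span_le_invariants (h.matAct_mem_span hu.1 hq) g hg]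
  have h1 := h.matAct_isRoot htriv hG ha hu hl
  rw [← hact l hl.mem, h.matAct_isRoot htriv hG ha' hs'.1 (hl.congr hact)] at h1
  rw [← hs'.2.2]
  exact (inv_injective (smul_left_injective ℂ hl.ne_zero h1)).symm

lemma QuotSetup.card_dvd (h : QuotSetup Wt G p d c) (htriv : TrivialConormal Wt p c)
    (hG : ∀ g ∈ G, ¬ IsReflection (g : Matrix (Fin n) (Fin n) ℂ))
    (hH : H ∈ reflHyps Wt) (hH' : H' ∈ reflHyps Wt) (himg : imageEq Wt G H H')
    (hs' : distinguishedGen Wt H' s') :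
    Nat.card ↥(Wt ⊓ pointStab H') ∣ Nat.card ↥(Wt ⊓ pointStab H) := by
  obtain ⟨g, hg, u, hu, hgu, hdet⟩ := h.exists_mul_eq htriv hG hH hH' himg hs'
  refine (h.isPrimitiveRoot_exp H').dvd_of_pow_eq_one _ ?_
  rw [← hdet]
  exact detHom_pow_card ⟨u, hu⟩

lemma QuotSetup.mul_inv_mem (h : QuotSetup Wt G p d c) (htriv : TrivialConormal Wt p c)
    (hG : ∀ g ∈ G, ¬ IsReflection (g : Matrix (Fin n) (Fin n) ℂ))
    (hH : H ∈ reflHyps Wt) (hH' : H' ∈ reflHyps Wt) (himg : imageEq Wt G H H')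
    (hs : distinguishedGen Wt H s) (hs' : distinguishedGen Wt H' s') : s' * s⁻¹ ∈ G := by
  obtain ⟨a, ha⟩ := exists_isEquation_of_mem_reflHyps hH
  obtain ⟨g, hg, u, hu, hgu, hdet⟩ := h.exists_mul_eq htriv hG hH hH' himg hs'
  rw [Nat.dvd_antisymm (h.card_dvd htriv hG hH hH' himg hs')
    (h.card_dvd htriv hG hH' hH (Eq.symm himg) hs)] at hdet
  rwa [hgu, h.eq_of_distinguishedGen ha hs hu hdet, mul_inv_cancel_right]

/-- A hyperplane on which the root of `H` vanishes has the same image as `H`. -/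
lemma IsRoot.imageEq_of_eval_eq_zero (h : QuotSetup Wt G p d c) (htriv : TrivialConormal Wt p c)
    (hG : ∀ g ∈ G, ¬ IsReflection (g : Matrix (Fin n) (Fin n) ℂ))
    (hH : H ∈ reflHyps Wt) (hs : distinguishedGen Wt H s) (hl : IsRoot p s l)
    (ha : IsEquation a H') (hvan : ∀ x ∈ H', eval x l = 0) :
    H' ∈ reflHyps Wt ∧ imageEq Wt G H H' := by
  have := h.finite_coe
  obtain ⟨g, hg, hsg⟩ := hl.exists_mem_pointStab h hvan
  have ht : s * g ∈ Wt ⊓ pointStab H' := ⟨Wt.mul_mem hs.1.1 (h.le hg), hsg⟩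
  have ht1 : s * g ≠ 1 := fun h1 =>
    hs.not_mem hH h hG (eq_inv_of_mul_eq_one_left h1 ▸ G.inv_mem hg)
  have hH' := ha.mem_reflHyps h ht ht1
  refine ⟨hH', (imageEq_iff h).mpr (le_antisymm ?_ ?_)⟩
  · refine hs.imageSubgroup_le h ?_
    rw [← mul_inv_cancel_right s g]
    exact mul_mem (inf_pointStab_le_imageSubgroup h ht) (le_imageSubgroup h (G.inv_mem hg))
  obtain ⟨s', hs'⟩ := h.exists_distinguishedGen ha
  obtain ⟨l', hl'⟩ := h.exists_isRoot htriv hG ha hs'.1 (hs'.ne_one hH')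
  obtain ⟨j, hj⟩ := (h.isOfFinOrder hs'.1.1).mem_powers_iff_mem_zpowers.mpr (hs'.2.1 _ ht)
  obtain ⟨q, hq, hql⟩ := (hl.mul_right h hg).jump
  obtain ⟨μ, hμ⟩ := hl'.exists_pow (h.matAct_isRoot htriv hG ha hs'.1 hl') j hq
  have hj' : s' ^ j = s * g := hj
  have hll' : l = μ • l' := add_left_cancel (hql.symm.trans (hj' ▸ hμ))
  have hμ0 : μ ≠ 0 := by
    rintro rfl
    exact hl.ne_zero (by rw [hll', zero_smul])
  obtain ⟨g', hg', hsg'⟩ := hl'.exists_mem_pointStab h (L := H) (fun x hx => by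
    obtain ⟨q, hq, hql⟩ := hl.jump
    have h1 := congrArg (eval x) hql
    rw [eval_matAct, (pointStab H).inv_mem hs.1.2 x hx, map_add, left_eq_add, hll',
      smul_eval] at h1
    exact (mul_eq_zero.mp h1).resolve_left hμ0)
  refine hs'.imageSubgroup_le h ?_
  rw [← mul_inv_cancel_right s' g']
  exact mul_mem (inf_pointStab_le_imageSubgroup h ⟨Wt.mul_mem hs'.1.1 (h.le hg'), hsg'⟩)
    (le_imageSubgroup h (G.inv_mem hg'))

/-- A polynomial vanishing on all hyperplanes with the same image as `H` is divisible by the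
root of `H`. -/
lemma IsRoot.dvd (h : QuotSetup Wt G p d c) (htriv : TrivialConormal Wt p c)
    (hG : ∀ g ∈ G, ¬ IsReflection (g : Matrix (Fin n) (Fin n) ℂ))
    (hH : H ∈ reflHyps Wt) (hs : distinguishedGen Wt H s) (hl : IsRoot p s l)
    {b : MvPolynomial (Fin n) ℂ}
    (hb : ∀ H' ∈ reflHyps Wt, imageEq Wt G H H' → ∀ x ∈ H', eval x b = 0) : l ∣ b := by
  have hsG := hs.not_mem hH h hG
  obtain ⟨N, hN⟩ := exists_dvd_pow_of_eval_eq_zero (l := l) (f := b) fun x hx => by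
    obtain ⟨f, hf, hfl⟩ := WfDvdMonoid.exists_factors l hl.ne_zero
    obtain ⟨u, hu⟩ := hfl
    have h0 : eval x f.prod = 0 := by
      have h1 := congrArg (eval x) hu
      rw [map_mul, hx] at h1
      exact (mul_eq_zero.mp h1).resolve_right (u.isUnit.map (eval x)).ne_zero
    rw [map_multiset_prod, Multiset.prod_eq_zero_iff, Multiset.mem_map] at h0
    obtain ⟨π, hπf, hπx⟩ := h0
    obtain ⟨a, H', ha, hassoc, hvan⟩ := hl.exists_associated_linForm h hsG (hf π hπf)
      ((Multiset.dvd_prod hπf).trans ⟨u, hu.symm⟩)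
    obtain ⟨hH', himg⟩ := hl.imageEq_of_eval_eq_zero h htriv hG hH hs ha hvan
    refine hb H' hH' himg x ((ha.2 x).mpr ?_)
    obtain ⟨e, he⟩ := hassoc.dvd
    rw [← eval_linForm, he, map_mul, hπx, zero_mul]
  exact (hl.squarefree h htriv hG hs.1.1 hsG).isRadical N b hN

end Distinguished

/-! ### The subgroup generated by the quotients of distinguished generators -/

section Generation

variable {n m : ℕ} {Wt G : Subgroup (Matrix.GeneralLinearGroup (Fin n) ℂ)}
  {p : Fin m → MvPolynomial (Fin n) ℂ} {d : Fin m → ℕ} {c : ↥Wt → Fin m → Fin m → ℂ}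
  {H H' : Submodule ℂ (Fin n → ℂ)} {s w : Matrix.GeneralLinearGroup (Fin n) ℂ}

/-- The image of a subspace under an invertible matrix. -/
def mapSubspace (w : Matrix.GeneralLinearGroup (Fin n) ℂ) (H : Submodule ℂ (Fin n → ℂ)) :
    Submodule ℂ (Fin n → ℂ) :=
  H.map (Matrix.toLin' (w : Matrix (Fin n) (Fin n) ℂ))

lemma conj_mem_pointStab_iff {u : Matrix.GeneralLinearGroup (Fin n) ℂ} :
    w * u * w⁻¹ ∈ pointStab (mapSubspace w H) ↔ u ∈ pointStab H := by
  have hconj : ∀ x, (↑(w * u * w⁻¹) : Matrix (Fin n) (Fin n) ℂ).mulVec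
      ((w : Matrix (Fin n) (Fin n) ℂ).mulVec x)
        = (w : Matrix (Fin n) (Fin n) ℂ).mulVec ((u : Matrix (Fin n) (Fin n) ℂ).mulVec x) := by
    intro x
    rw [Units.val_mul, Units.val_mul, ← Matrix.mulVec_mulVec, ← Matrix.mulVec_mulVec,
      mulVec_inv_mulVec]
  constructor
  · intro hu x hx
    have h1 := hu _ (Submodule.mem_map_of_mem hx)
    rw [Matrix.toLin'_apply, hconj] at h1
    exact (Function.LeftInverse.injective (mulVec_inv_mulVec w)) h1
  · rintro hu _ ⟨x, hx, rfl⟩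
    rw [Matrix.toLin'_apply, hconj, hu x hx]

lemma conj_mem_inf_pointStab_iff (hw : w ∈ Wt) {u : Matrix.GeneralLinearGroup (Fin n) ℂ} :
    w * u * w⁻¹ ∈ Wt ⊓ pointStab (mapSubspace w H) ↔ u ∈ Wt ⊓ pointStab H := by
  rw [Subgroup.mem_inf, Subgroup.mem_inf, conj_mem_pointStab_iff,
    Subgroup.mul_mem_cancel_right _ (Wt.inv_mem hw), Subgroup.mul_mem_cancel_left _ hw]

lemma card_inf_pointStab_mapSubspace (hw : w ∈ Wt) :
    Nat.card ↥(Wt ⊓ pointStab (mapSubspace w H)) = Nat.card ↥(Wt ⊓ pointStab H) :=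
  (Nat.card_congr ((MulAut.conj w).toEquiv.subtypeEquiv
    fun _ => (conj_mem_inf_pointStab_iff hw).symm)).symm

lemma distinguishedGen.conj (hs : distinguishedGen Wt H s) (hw : w ∈ Wt) :
    distinguishedGen Wt (mapSubspace w H) (w * s * w⁻¹) := by
  refine ⟨(conj_mem_inf_pointStab_iff hw).mpr hs.1, fun u hu => ?_, ?_⟩
  · have hu' : u = w * (w⁻¹ * u * w) * w⁻¹ := by group
    rw [hu'] at hu ⊢
    obtain ⟨j, hj⟩ := hs.2.1 _ ((conj_mem_inf_pointStab_iff hw).mp hu)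
    exact ⟨j, by rw [← hj]; exact conj_zpow⟩
  · rw [card_inf_pointStab_mapSubspace hw, ← hs.2.2, Units.val_mul, Units.val_mul,
      Matrix.det_mul_right_comm, ← Units.val_mul, mul_inv_cancel, Units.val_one, one_mul]

lemma QuotSetup.mapSubspace_mem_reflHyps' (h : QuotSetup Wt G p d c)
    (hG : ∀ g ∈ G, ¬ IsReflection (g : Matrix (Fin n) (Fin n) ℂ)) (hw : w ∈ Wt)
    (hH : H ∈ reflHyps Wt) : mapSubspace w H ∈ reflHyps' Wt G := by
  obtain ⟨a, ha⟩ := exists_isEquation_of_mem_reflHyps hH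
  obtain ⟨s, hs⟩ := h.exists_distinguishedGen ha
  have hfin : Module.finrank ℂ (mapSubspace w H) + 1 = n := by
    have hinj : Function.Injective (Matrix.toLin' (w : Matrix (Fin n) (Fin n) ℂ)) :=
      Function.LeftInverse.injective (mulVec_inv_mulVec w)
    rw [mapSubspace, ← (Submodule.equivMapOfInjective _ hinj H).finrank_eq, ha.finrank]
  obtain ⟨a', ha'⟩ := exists_isEquation hfin
  have hs' := hs.conj hw
  have hH' := ha'.mem_reflHyps h hs'.1 (fun h1 => hs.ne_one hH (conj_eq_one_iff.mp h1))
  exact ⟨hH', fun hle => hs'.not_mem hH' h hG (hle hs'.1)⟩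

lemma QuotSetup.mem_reflHyps' (h : QuotSetup Wt G p d c)
    (hG : ∀ g ∈ G, ¬ IsReflection (g : Matrix (Fin n) (Fin n) ℂ))
    (hH : H ∈ reflHyps Wt) : H ∈ reflHyps' Wt G := by
  obtain ⟨a, ha⟩ := exists_isEquation_of_mem_reflHyps hH
  obtain ⟨s, hs⟩ := h.exists_distinguishedGen ha
  exact ⟨hH, fun hle => hs.not_mem hH h hG (hle hs.1)⟩

lemma QuotSetup.mem_imageSubgroup_mapSubspace (h : QuotSetup Wt G p d c) (hw : w ∈ Wt)
    {x : Matrix.GeneralLinearGroup (Fin n) ℂ} :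
    w * x * w⁻¹ ∈ imageSubgroup h (mapSubspace w H) ↔ x ∈ imageSubgroup h H := by
  constructor
  · rintro ⟨g, hg, u, hu, hx⟩
    have hu' : u = w * (w⁻¹ * u * w) * w⁻¹ := by group
    rw [hu'] at hu
    refine ⟨w⁻¹ * g * w⁻¹⁻¹, h.normal _ (Wt.inv_mem hw) g hg, w⁻¹ * u * w,
      (conj_mem_inf_pointStab_iff hw).mp hu, ?_⟩
    have hx' : x = w⁻¹ * (w * x * w⁻¹) * w := by group
    rw [hx', hx]
    group
  · rintro ⟨g, hg, u, hu, rfl⟩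
    exact ⟨w * g * w⁻¹, h.normal w hw g hg, w * u * w⁻¹, (conj_mem_inf_pointStab_iff hw).mpr hu,
      by group⟩

lemma QuotSetup.imageEq_mapSubspace (h : QuotSetup Wt G p d c) (hw : w ∈ Wt)
    (himg : imageEq Wt G H H') : imageEq Wt G (mapSubspace w H) (mapSubspace w H') := by
  rw [imageEq_iff h] at himg ⊢
  ext x
  have hx : x = w * (w⁻¹ * x * w) * w⁻¹ := by group
  rw [hx, h.mem_imageSubgroup_mapSubspace hw, h.mem_imageSubgroup_mapSubspace hw, himg]

/-- The subgroup generated by the quotients of distinguished generators with the same image. -/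
def quotGenSubgroup (Wt G : Subgroup (Matrix.GeneralLinearGroup (Fin n) ℂ)) :
    Subgroup (Matrix.GeneralLinearGroup (Fin n) ℂ) :=
  Subgroup.closure
      {g : Matrix.GeneralLinearGroup (Fin n) ℂ |
        ∃ H ∈ reflHyps' Wt G, ∃ H' ∈ reflHyps' Wt G, imageEq Wt G H H' ∧
          ∃ s s' : Matrix.GeneralLinearGroup (Fin n) ℂ,
            distinguishedGen Wt H s ∧ distinguishedGen Wt H' s' ∧ g = s' * s⁻¹}

lemma QuotSetup.quotGenSubgroup_le (h : QuotSetup Wt G p d c) (htriv : TrivialConormal Wt p c)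
    (hG : ∀ g ∈ G, ¬ IsReflection (g : Matrix (Fin n) (Fin n) ℂ)) :
    quotGenSubgroup Wt G ≤ G := by
  refine (Subgroup.closure_le _).mpr ?_
  rintro _ ⟨H, hH, H', hH', himg, s, s', hs, hs', rfl⟩
  exact h.mul_inv_mem htriv hG hH.1 hH'.1 himg hs hs'

lemma QuotSetup.conj_mem_quotGenSubgroup (h : QuotSetup Wt G p d c)
    (hG : ∀ g ∈ G, ¬ IsReflection (g : Matrix (Fin n) (Fin n) ℂ)) (hw : w ∈ Wt)
    {g : Matrix.GeneralLinearGroup (Fin n) ℂ} (hg : g ∈ quotGenSubgroup Wt G) :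
    w * g * w⁻¹ ∈ quotGenSubgroup Wt G := by
  have hle : quotGenSubgroup Wt G ≤ (quotGenSubgroup Wt G).comap (MulAut.conj w).toMonoidHom := by
    refine (Subgroup.closure_le _).mpr ?_
    rintro _ ⟨H, hH, H', hH', himg, s, s', hs, hs', rfl⟩
    refine Subgroup.subset_closure ⟨mapSubspace w H, h.mapSubspace_mem_reflHyps' hG hw hH.1,
      mapSubspace w H', h.mapSubspace_mem_reflHyps' hG hw hH'.1, h.imageEq_mapSubspace hw himg,
      w * s * w⁻¹, w * s' * w⁻¹, hs.conj hw, hs'.conj hw, ?_⟩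
    change w * (s' * s⁻¹) * w⁻¹ = _
    group
  exact hle hg

lemma matAct_mem_invariants_of_conj {N : Subgroup (Matrix.GeneralLinearGroup (Fin n) ℂ)}
    (hN : ∀ g ∈ N, w⁻¹ * g * w ∈ N) {b : MvPolynomial (Fin n) ℂ} (hb : b ∈ invariants N) :
    matAct w b ∈ invariants N := by
  intro g hg
  rw [← matAct_mul]
  have hgw : g * w = w * (w⁻¹ * g * w) := by group
  rw [hgw, matAct_mul, hb _ (hN g hg)]

lemma QuotSetup.matAct_mem_invariants (h : QuotSetup Wt G p d c) (hw : w ∈ Wt)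
    {b : MvPolynomial (Fin n) ℂ} (hb : b ∈ invariants G) : matAct w b ∈ invariants G :=
  matAct_mem_invariants_of_conj (fun g hg => by
    simpa using h.normal w⁻¹ (Wt.inv_mem hw) g hg) hb

lemma QuotSetup.matAct_mem_invariants_quotGenSubgroup (h : QuotSetup Wt G p d c)
    (hG : ∀ g ∈ G, ¬ IsReflection (g : Matrix (Fin n) (Fin n) ℂ)) (hw : w ∈ Wt)
    {b : MvPolynomial (Fin n) ℂ} (hb : b ∈ invariants (quotGenSubgroup Wt G)) :
    matAct w b ∈ invariants (quotGenSubgroup Wt G) :=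
  matAct_mem_invariants_of_conj (fun g hg => by
    simpa using h.conj_mem_quotGenSubgroup hG (Wt.inv_mem hw) hg) hb

/-- If all distinguished reflections move `b` by a `G`-invariant, then so do all elements
of `Wt`. -/
lemma QuotSetup.matAct_sub_mem_invariants (h : QuotSetup Wt G p d c)
    {b : MvPolynomial (Fin n) ℂ}
    (hb : ∀ H ∈ reflHyps Wt, ∀ s, distinguishedGen Wt H s → matAct s b - b ∈ invariants G)
    (hw : w ∈ Wt) : matAct w b - b ∈ invariants G := by
  let T : Subgroup (Matrix.GeneralLinearGroup (Fin n) ℂ) :=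
    { carrier := {w | w ∈ Wt ∧ matAct w b - b ∈ invariants G}
      one_mem' := ⟨one_mem _, by rw [matAct_one, sub_self]; exact zero_mem _⟩
      mul_mem' := by
        rintro u w ⟨hu, hub⟩ ⟨hw, hwb⟩
        refine ⟨mul_mem hu hw, ?_⟩
        have h1 := add_mem (h.matAct_mem_invariants hu hwb) hub
        rwa [map_sub, ← matAct_mul, sub_add_sub_cancel] at h1
      inv_mem' := by
        rintro w ⟨hw, hwb⟩
        refine ⟨inv_mem hw, ?_⟩
        have h1 := neg_mem (h.matAct_mem_invariants (inv_mem hw) hwb)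
        rwa [map_sub, matAct_inv_matAct, neg_sub] at h1 }
  have hle : Wt ≤ T := by
    nth_rw 1 [← h.reflGroup]
    refine (Subgroup.closure_le _).mpr ?_
    rintro u ⟨hu, hur⟩
    obtain ⟨a, ha⟩ := exists_isEquation hur.2
    obtain ⟨s, hs⟩ := h.exists_distinguishedGen ha
    have hsT : s ∈ T := ⟨hs.1.1, hb _ ⟨u, hu, hur, rfl⟩ s hs⟩
    exact Subgroup.zpowers_le.mpr hsT (hs.2.1 u ⟨hu, fun x hx => mem_fixedSpace.mp hx⟩)
  exact (hle hw).2

lemma QuotSetup.mem_invariants_of_quotGenSubgroup (h : QuotSetup Wt G p d c)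
    (htriv : TrivialConormal Wt p c)
    (hG : ∀ g ∈ G, ¬ IsReflection (g : Matrix (Fin n) (Fin n) ℂ)) :
    ∀ b ∈ invariants (quotGenSubgroup Wt G), b ∈ invariants G := by
  intro b
  induction hD : b.totalDegree using Nat.strong_induction_on generalizing b with
  | _ D ih =>
  intro hb
  have hdiff : ∀ H ∈ reflHyps Wt, ∀ s, distinguishedGen Wt H s →
      matAct s b - b ∈ invariants G := by
    intro H hH s hs
    obtain ⟨a, ha⟩ := exists_isEquation_of_mem_reflHyps hH
    obtain ⟨l, hl⟩ := h.exists_isRoot htriv hG ha hs.1 (hs.ne_one hH)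
    have hlG := h.span_le_invariants hl.mem
    have hsb := h.matAct_mem_invariants_quotGenSubgroup hG hs.1.1 hb
    obtain ⟨e, he⟩ : l ∣ matAct s b - b := by
      refine hl.dvd h htriv hG hH hs fun H' hH' himg x hx => ?_
      obtain ⟨a', ha'⟩ := exists_isEquation_of_mem_reflHyps hH'
      obtain ⟨s', hs'⟩ := h.exists_distinguishedGen ha'
      have h1 := hsb (s' * s⁻¹) (Subgroup.subset_closure ⟨H, h.mem_reflHyps' hG hH, H',
        h.mem_reflHyps' hG hH', himg, s, s', hs, hs', rfl⟩)
      rw [← matAct_mul, inv_mul_cancel_right] at h1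
      rw [← h1, map_sub, eval_matAct, (pointStab H').inv_mem hs'.1.2 x hx, sub_self]
    have heN : e ∈ invariants (quotGenSubgroup Wt G) := by
      intro g hg
      have h1 := sub_mem hsb hb g hg
      rw [he, map_mul, hlG g (h.quotGenSubgroup_le htriv hG hg)] at h1
      exact mul_left_cancel₀ hl.ne_zero h1
    rw [he]
    refine mul_mem hlG ?_
    by_cases he0 : e = 0
    · rw [he0]
      exact zero_mem _
    refine ih e.totalDegree ?_ e rfl heN
    have hdeg : (l * e).totalDegree ≤ D := by
      rw [← he, ← hD]
      exact (totalDegree_sub _ _).trans (max_le (totalDegree_matAct_le s b) le_rfl)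
    rw [totalDegree_mul_of_isDomain hl.ne_zero he0] at hdeg
    have hldeg : l.totalDegree ≠ 0 := by
      intro h0
      have hlC := totalDegree_eq_zero_iff_eq_C.mp h0
      have hl0 : eval 0 l = 0 := by
        obtain ⟨a, rfl⟩ := (Submodule.mem_span_range_iff_exists_fun ℂ).mp hl.mem
        simp only [map_sum, smul_eval, h.eval_zero_generator, mul_zero, Finset.sum_const_zero]
      rw [hlC, eval_C] at hl0
      exact hl.ne_zero (by rw [hlC, hl0, map_zero])
    omega
  intro g hg
  have h1 := h.matAct_sub_mem_invariants hdiff (h.le hg)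
  have h2 := matAct_eq_self_of_sub_fixed (h.isOfFinOrder (h.le hg))
    (add_sub_cancel b (matAct g b)).symm (h1 g hg)
  exact sub_eq_zero.mp h2

end Generation

/-- if `G` is good and contains no reflection, then `G` is generated by
the elements `s_{H'} s_H⁻¹`, where `{H, H'}` runs over pairs of hyperplanes of `A'(Wt)`
with the same image in `A'bar(Wt)`. -/
theorem statement15 {n m : ℕ}
    (Wt G : Subgroup (Matrix.GeneralLinearGroup (Fin n) ℂ))
    (p : Fin m → MvPolynomial (Fin n) ℂ) (d : Fin m → ℕ)
    (c : ↥Wt → Fin m → Fin m → ℂ)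
    (hsetup : QuotSetup Wt G p d c)
    (hgood : IsGoodQuot Wt p c)
    (hnorefl : ∀ g ∈ G, ¬ IsReflection ((g : Matrix (Fin n) (Fin n) ℂ))) :
    Subgroup.closure
      {g : Matrix.GeneralLinearGroup (Fin n) ℂ |
        ∃ H ∈ reflHyps' Wt G, ∃ H' ∈ reflHyps' Wt G, imageEq Wt G H H' ∧
          ∃ s s' : Matrix.GeneralLinearGroup (Fin n) ℂ,
            distinguishedGen Wt H s ∧ distinguishedGen Wt H' s' ∧ g = s' * s⁻¹} = G := by
  have := hsetup.finite_normal
  have hle := hsetup.quotGenSubgroup_le hgood.2 hnorefl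
  exact le_antisymm hle fun g hg => mem_of_fixes_invariants hle hg fun b hb =>
    hsetup.mem_invariants_of_quotGenSubgroup hgood.2 hnorefl b hb g hg

end ReflQuot
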